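/- Let X be a reflexive separable real Banach space, let f : X → ℝ be quasiconvex and densely continuous, and let m ∈ ℝ be the topological essential infimum of f. If F_m = {x ∈ X : f(x) < m} is nowhere dense, then the set of points of X at which f is not Hadamard differentiable is contained in a Haar null set. -/

import Mathlib

open Filter Topology Set MeasureTheory

/-- `f` is quasiconvex: `f (l•x + (1-l)•y) ≤ max (f x) (f y)` for `l ∈ [0,1]`. -/
def QuasiconvexFun {X : Type*} [AddCommGroup X] [Module ℝ X] (f : X → ℝ) : Prop :=
  ∀ x y : X, ∀ l : ℝ, l ∈ Set.Icc (0 : ℝ) 1 →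
    f (l • x + (1 - l) • y) ≤ max (f x) (f y)

/-- `f` is strictly quasiconvex. -/
def StrictlyQuasiconvexFun {X : Type*} [AddCommGroup X] [Module ℝ X] (f : X → ℝ) : Prop :=
  ∀ x y : X, x ≠ y → ∀ l : ℝ, l ∈ Set.Ioo (0 : ℝ) 1 →
    f (l • x + (1 - l) • y) < max (f x) (f y)

/-- `f` is densely continuous: its set of points of continuity is dense. -/
def DenselyContinuous {X : Type*} [TopologicalSpace X] (f : X → ℝ) : Prop :=
  Dense {x : X | ContinuousAt f x}

/-- `m` is the topological essential infimum of `f`: the strict sublevel set `{f < α}`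
is meager for `α < m` and nonmeager for `α > m`. -/
def IsTopEssInf {X : Type*} [TopologicalSpace X] (f : X → ℝ) (m : ℝ) : Prop :=
  (∀ α : ℝ, α < m → IsMeagre {x : X | f x < α}) ∧
  (∀ α : ℝ, m < α → ¬ IsMeagre {x : X | f x < α})

/-- Aronszajn null set: a Borel set `N` such that for every sequence `ξ` with dense linear
span, `N` decomposes as a countable union of Borel sets, the `n`-th of which has Lebesgue
null intersection with every line of direction `ξ n`. -/
def AronszajnNull {X : Type*} [NormedAddCommGroup X] [NormedSpace ℝ X]
    [MeasurableSpace X] (N : Set X) : Prop :=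
  MeasurableSet N ∧
  ∀ ξ : ℕ → X, Dense (Submodule.span ℝ (Set.range ξ) : Set X) →
    ∃ Nn : ℕ → Set X, N = ⋃ n, Nn n ∧
      ∀ n, MeasurableSet (Nn n) ∧
        ∀ x : X, MeasureTheory.volume {t : ℝ | x + t • ξ n ∈ Nn n} = 0

/-- Haar null set: `E` is contained in a Borel set `B` for which there is a Borel
probability measure vanishing on all translates of `B`. -/
def HaarNull {X : Type*} [AddCommGroup X] [TopologicalSpace X]
    [MeasurableSpace X] (E : Set X) : Prop :=
  ∃ B : Set X, E ⊆ B ∧ MeasurableSet B ∧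
    ∃ μ : MeasureTheory.Measure X, MeasureTheory.IsProbabilityMeasure μ ∧
      ∀ x : X, μ ((fun y => x + y) '' B) = 0

/-- Hadamard differentiability of `f` at `x`. -/
def HadamardDiffAt {X : Type*} [NormedAddCommGroup X] [NormedSpace ℝ X]
    (f : X → ℝ) (x : X) : Prop :=
  ∃ L : X →L[ℝ] ℝ, ∀ h : X, ∀ t : ℕ → ℝ, (∀ n, t n ≠ 0) →
    Tendsto t atTop (𝓝 0) → ∀ hs : ℕ → X, Tendsto hs atTop (𝓝 h) →
      Tendsto (fun n => (f (x + t n • hs n) - f x) / t n) atTop (𝓝 (L h))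

/-- Hadamard differentiability at `x` of a function whose relevant values are those on `V`. -/
def HadamardDiffWithinAt {X : Type*} [NormedAddCommGroup X] [NormedSpace ℝ X]
    (f : X → ℝ) (V : Set X) (x : X) : Prop :=
  ∃ L : X →L[ℝ] ℝ, ∀ h : X, ∀ t : ℕ → ℝ, (∀ n, t n ≠ 0) →
    Tendsto t atTop (𝓝 0) → ∀ hs : ℕ → X, Tendsto hs atTop (𝓝 h) →
      (∀ n, x + t n • hs n ∈ V) →
      Tendsto (fun n => (f (x + t n • hs n) - f x) / t n) atTop (𝓝 (L h))

/-- Gâteaux differentiability of `f` at `x` with derivative `L`. -/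
def GateauxDiffAt {X : Type*} [NormedAddCommGroup X] [NormedSpace ℝ X]
    (f : X → ℝ) (x : X) (L : X →L[ℝ] ℝ) : Prop :=
  ∀ h : X, Tendsto (fun t : ℝ => (f (x + t • h) - f x) / t) (𝓝[≠] 0) (𝓝 (L h))

/-- Essential Gâteaux differentiability of `f` at `x`: directional derivatives exist and
are given by a continuous linear functional for a comeager (residual) set of directions
in the unit sphere. -/
def EssGateauxDiffAt {X : Type*} [NormedAddCommGroup X] [NormedSpace ℝ X]
    (f : X → ℝ) (x : X) : Prop :=
  ∃ L : X →L[ℝ] ℝ, ∃ Ω : Set (Metric.sphere (0 : X) 1), IsMeagre Ωᶜ ∧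
    ∀ h ∈ Ω, Tendsto (fun t : ℝ => (f (x + t • (h : X)) - f x) / t) (𝓝[≠] 0) (𝓝 (L (h : X)))

/-- `K` is a closed convex cone. -/
def IsClosedConvexCone {X : Type*} [NormedAddCommGroup X] [NormedSpace ℝ X] (K : Set X) : Prop :=
  IsClosed K ∧ Convex ℝ K ∧ ∀ l : ℝ, 0 ≤ l → ∀ k ∈ K, l • k ∈ K

/-- `f` is `K`-nondecreasing on `U`. -/
def KNondecreasingOn {X : Type*} [AddCommGroup X] [Module ℝ X]
    (f : X → ℝ) (K U : Set X) : Prop :=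
  ∀ u ∈ U, ∀ k ∈ K, k ≠ 0 → u + k ∈ U → f u ≤ f (u + k)

/-- Ideally convex subset: stable under infinite convex combinations of bounded sequences. -/
def IdeallyConvex {X : Type*} [NormedAddCommGroup X] [NormedSpace ℝ X] (C : Set X) : Prop :=
  ∀ (x : ℕ → X) (lam : ℕ → ℝ), (∀ n, x n ∈ C) → Bornology.IsBounded (Set.range x) →
    (∀ n, lam n ∈ Set.Icc (0 : ℝ) 1) → HasSum lam 1 →
      ∑' n, lam n • x n ∈ C

/-- `C‡`: the union, over finite dimensional subspaces `Z ⊆ X`, of the closures of `C ∩ Z`. -/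
def Ddag {X : Type*} [NormedAddCommGroup X] [NormedSpace ℝ X] (C : Set X) : Set X :=
  ⋃ (Z : Submodule ℝ X) (_ : FiniteDimensional ℝ Z), closure (C ∩ (Z : Set X))

/-- A normed space is reflexive if the canonical inclusion into its double dual is onto. -/
def IsReflexiveSpace (X : Type*) [NormedAddCommGroup X] [NormedSpace ℝ X] : Prop :=
  Function.Surjective (NormedSpace.inclusionInDoubleDual ℝ X)



lemma exists_prob_conv {X : Type*} [NormedAddCommGroup X] [NormedSpace ℝ X] [CompleteSpace X]
    [TopologicalSpace.SeparableSpace X] [MeasurableSpace X] [BorelSpace X]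
    {ι : Type*} [Countable ι] (ε : ι → ℝ) (hs : Summable ε) (hpos : ∀ i, 0 ≤ ε i)
    (ν : ι → Measure X) (hprob : ∀ i, IsProbabilityMeasure (ν i))
    (hν : ∀ i, ν i (Metric.closedBall 0 (ε i))ᶜ = 0) :
    ∃ μ : Measure X, IsProbabilityMeasure μ ∧ ∀ i, ∃ ρ : Measure X, IsProbabilityMeasure ρ ∧
      ∀ B, MeasurableSet B → μ B = ∫⁻ z, ν i {y | z + y ∈ B} ∂ρ := by
  classical
  have : SecondCountableTopology X := UniformSpace.secondCountable_of_separable X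
  let g : ι → X → X := fun i x => (Metric.closedBall (0 : X) (ε i)).indicator id x
  have hgm : ∀ i, Measurable (g i) := fun i =>
    measurable_id.indicator Metric.isClosed_closedBall.measurableSet
  have hgb : ∀ i x, ‖g i x‖ ≤ ε i := by
    intro i x
    by_cases hx : x ∈ Metric.closedBall (0 : X) (ε i)
    · simp only [g, indicator_of_mem hx, id]
      simpa using hx
    · simp only [g, indicator_of_notMem hx, norm_zero]
      exact hpos i
  have hgae : ∀ i, g i =ᵐ[ν i] id := by
    intro i
    refine measure_mono_null ?_ (hν i)
    intro x hx
    simp only [mem_compl_iff]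
    intro hx'
    exact hx (by simp [g, indicator_of_mem hx'])
  let P : Measure (ι → X) := Measure.infinitePi ν
  let S : (ι → X) → X := fun ω => ∑' i, g i (ω i)
  let R : ι → (ι → X) → X := fun i ω => ∑' j, (if j = i then 0 else g j (ω j))
  have hsum : ∀ ω : ι → X, Summable (fun i => g i (ω i)) := fun ω =>
    Summable.of_norm_bounded hs (fun i => hgb i (ω i))
  have hsumR : ∀ i, ∀ ω : ι → X, Summable (fun j => if j = i then 0 else g j (ω j)) := by
    intro i ω
    refine Summable.of_norm_bounded hs (fun j => ?_)
    split_ifs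
    · simpa using hpos j
    · exact hgb j (ω j)
  have hS : ∀ i ω, S ω = R i ω + g i (ω i) := by
    intro i ω
    have := (hsum ω).tsum_eq_add_tsum_ite i
    simp only [S, R]
    rw [this, add_comm]
  have hRm' : ∀ i, Measurable[⨆ j ∈ ({i}ᶜ : Set ι), MeasurableSpace.comap (fun ω : ι → X => ω j) inferInstance] (R i) := by
    intro i
    refine @measurable_of_tendsto_metrizable' (ι → X) X (⨆ j ∈ ({i}ᶜ : Set ι), MeasurableSpace.comap (fun ω : ι → X => ω j) inferInstance) _ _ _ _ (Finset ι)
      (fun (s : Finset ι) ω => ∑ j ∈ s, (if j = i then 0 else g j (ω j))) (R i) atTop _ _ ?_ ?_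
    · intro s
      refine Finset.measurable_fun_sum s (fun j _ => ?_)
      by_cases hj : j = i
      · simp only [hj, if_true]
        exact measurable_const
      · simp only [hj, if_false]
        refine (hgm j).comp ?_
        have h1 : MeasurableSpace.comap (fun ω : ι → X => ω j) inferInstance ≤
          (⨆ j ∈ ({i}ᶜ : Set ι), MeasurableSpace.comap (fun ω : ι → X => ω j) inferInstance) :=
          le_iSup₂_of_le j (by simpa using hj) le_rfl
        exact (comap_measurable _).mono h1 le_rfl
    · rw [tendsto_pi_nhds]
      intro ω
      exact (hsumR i ω).hasSum
  have hle : ∀ j, MeasurableSpace.comap (fun ω : ι → X => ω j) inferInstance ≤ (inferInstance : MeasurableSpace (ι → X)) :=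
    fun j => (measurable_pi_apply j).comap_le
  have hRm : ∀ i, Measurable (R i) := fun i =>
    (hRm' i).mono (iSup₂_le fun j _ => hle j) le_rfl
  have hgm' : ∀ i, Measurable (fun ω : ι → X => g i (ω i)) := fun i =>
    (hgm i).comp (measurable_pi_apply i)
  have hind : ProbabilityTheory.iIndepFun (fun i (ω : ι → X) => ω i) P := by
    have := ProbabilityTheory.iIndepFun_infinitePi (P := ν) (X := fun i (x : X) => x) (fun i => measurable_id)
    simpa using this
  have hI : ∀ i, ProbabilityTheory.IndepFun (R i) (fun ω : ι → X => g i (ω i)) P := by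
    intro i
    have h1 := ProbabilityTheory.indep_iSup_of_disjoint hle hind
      (S := {i}ᶜ) (T := {i}) disjoint_compl_left
    rw [ProbabilityTheory.IndepFun_iff_Indep]
    refine ProbabilityTheory.indep_of_indep_of_le_left
      (ProbabilityTheory.indep_of_indep_of_le_right h1 ?_) ?_
    · rw [iSup_singleton]
      have : Measurable[MeasurableSpace.comap (fun ω : ι → X => ω i) inferInstance] (fun ω : ι → X => g i (ω i)) :=
        (hgm i).comp (comap_measurable _)
      exact this.comap_le
    · exact (hRm' i).comap_le
  have hSm : Measurable S := by
    by_cases hne : Nonempty ι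
    · obtain ⟨i⟩ := hne
      have : S = fun ω => R i ω + g i (ω i) := funext (hS i)
      rw [this]
      exact (hRm i).add (hgm' i)
    · have : IsEmpty ι := not_nonempty_iff.mp hne
      have : S = fun _ => 0 := by
        funext ω; simp [S]
      rw [this]; exact measurable_const
  refine ⟨P.map S, Measure.isProbabilityMeasure_map hSm.aemeasurable, fun i => ?_⟩
  refine ⟨P.map (R i), Measure.isProbabilityMeasure_map (hRm i).aemeasurable, fun B hB => ?_⟩
  have hlaw : P.map (fun ω : ι → X => g i (ω i)) = ν i := by
    have h1 : P.map (fun ω : ι → X => ω i) = ν i := Measure.infinitePi_map_eval ν i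
    have h2 : P.map (fun ω : ι → X => g i (ω i)) = (P.map (fun ω : ι → X => ω i)).map (g i) := by
      rw [Measure.map_map (hgm i) (measurable_pi_apply i)]; rfl
    rw [h2, h1, Measure.map_congr (hgae i), Measure.map_id]
  have hp := (ProbabilityTheory.indepFun_iff_map_prod_eq_prod_map_map (hRm i).aemeasurable
    (hgm' i).aemeasurable).1 (hI i)
  rw [hlaw] at hp
  have hadd : MeasurableSet {p : X × X | p.1 + p.2 ∈ B} := (measurable_fst.add measurable_snd) hB
  have h3 : P.map S B = (P.map (fun ω => (R i ω, g i (ω i)))) {p : X × X | p.1 + p.2 ∈ B} := by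
    rw [Measure.map_apply hSm hB, Measure.map_apply ((hRm i).prodMk (hgm' i)) hadd]
    congr 1
    ext ω
    simp [hS i ω]
  rw [h3, hp, Measure.prod_apply hadd]
  rfl


lemma nested_nonempty_of_reflexive {X : Type*} [NormedAddCommGroup X] [NormedSpace ℝ X]
    (hrefl : IsReflexiveSpace X) (t : ℕ → Set X) (htd : ∀ i, t (i + 1) ⊆ t i)
    (htn : ∀ i, (t i).Nonempty) (hcl : ∀ i, IsClosed (t i)) (hcv : ∀ i, Convex ℝ (t i))
    (hb : Bornology.IsBounded (t 0)) : (⋂ i, t i).Nonempty := by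
  let T : ℕ → Set (WeakDual ℝ (StrongDual ℝ X)) := fun i =>
    {φ | ∀ (f : StrongDual ℝ X) (c : ℝ), (∀ x ∈ t i, f x ≤ c) → φ f ≤ c}
  have hTcl : ∀ i, IsClosed (T i) := by
    intro i
    have : T i = ⋂ (f : StrongDual ℝ X) (c : ℝ) (_ : ∀ x ∈ t i, f x ≤ c),
        {φ : WeakDual ℝ (StrongDual ℝ X) | φ f ≤ c} := by
      ext φ; simp [T]
    rw [this]
    refine isClosed_iInter fun f => isClosed_iInter fun c => isClosed_iInter fun _ => ?_
    exact isClosed_le (WeakDual.eval_continuous f) continuous_const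
  obtain ⟨R, hR⟩ := hb.exists_norm_le
  have hR0 : 0 ≤ R := by
    obtain ⟨x, hx⟩ := htn 0
    exact (norm_nonneg x).trans (hR x hx)
  have hcomp : IsCompact (T 0) := by
    refine (WeakDual.isCompact_closedBall (𝕜 := ℝ) (E := StrongDual ℝ X) 0 R).of_isClosed_subset
      (hTcl 0) ?_
    intro φ hφ
    have h1 : ∀ f : StrongDual ℝ X, φ f ≤ R * ‖f‖ := by
      intro f
      refine hφ f _ fun x hx => ?_
      calc f x ≤ ‖f x‖ := Real.le_norm_self _
        _ ≤ ‖f‖ * ‖x‖ := f.le_opNorm x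
        _ ≤ R * ‖f‖ := by
          rw [mul_comm]; exact mul_le_mul_of_nonneg_right (hR x hx) (norm_nonneg _)
    simp only [mem_preimage, Metric.mem_closedBall, dist_zero_right]
    refine ContinuousLinearMap.opNorm_le_bound _ hR0 fun f => ?_
    rw [Real.norm_eq_abs, abs_le]
    constructor
    · have := h1 (-f)
      rw [map_neg, norm_neg] at this
      have h2 : (WeakDual.toStrongDual φ) f = φ f := rfl
      rw [h2]; linarith
    · exact h1 f
  have hne : ∀ i, (T i).Nonempty := by
    intro i
    obtain ⟨x, hx⟩ := htn i
    refine ⟨StrongDual.toWeakDual (NormedSpace.inclusionInDoubleDual ℝ X x), ?_⟩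
    intro f c hf
    exact hf x hx
  have hdec : ∀ i, T (i + 1) ⊆ T i := by
    intro i φ hφ f c hf
    exact hφ f c fun x hx => hf x (htd i hx)
  obtain ⟨φ, hφ⟩ := IsCompact.nonempty_iInter_of_sequence_nonempty_isCompact_isClosed T hdec hne
    hcomp hTcl
  obtain ⟨x, hx⟩ := hrefl (WeakDual.toStrongDual φ)
  refine ⟨x, mem_iInter.2 fun i => ?_⟩
  by_contra hxi
  obtain ⟨f, u, hu, hfx⟩ := geometric_hahn_banach_closed_point (hcv i) (hcl i) hxi
  have h1 : φ f ≤ u := (mem_iInter.1 hφ i) f u fun y hy => (hu y hy).le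
  have h2 : φ f = f x := by
    have : (WeakDual.toStrongDual φ) f = f x := by rw [← hx]; rfl
    exact this
  linarith

/-- auxiliary property in the proof of the lemma of Ptak -/
def PtakProp {W : Type*} (A : ℕ → Set W) (D : Set W) : Prop :=
  ∀ h : ℕ → (W → ℝ),
    (∀ n, h n ∈ convexHull ℝ ((fun i => (A i).indicator (fun _ => (1 : ℝ))) '' Ici n)) →
    ∀ δ : ℝ, 0 < δ → ∀ n, ∃ g ∈ convexHull ℝ (h '' Ici n), ∀ x ∈ D, g x ≤ δ

lemma PtakProp.empty {W : Type*} (A : ℕ → Set W) : PtakProp A ∅ := by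
  intro h _ δ _ n
  exact ⟨h n, subset_convexHull ℝ _ ⟨n, mem_Ici.2 le_rfl, rfl⟩, by simp⟩

lemma hull_trans {W : Type*} {h g : ℕ → (W → ℝ)}
    (hg : ∀ n, g n ∈ convexHull ℝ (h '' Ici n)) (n : ℕ) :
    convexHull ℝ (g '' Ici n) ⊆ convexHull ℝ (h '' Ici n) := by
  refine convexHull_min ?_ (convex_convexHull ℝ _)
  rintro _ ⟨i, hi, rfl⟩
  refine convexHull_mono ?_ (hg i)
  exact image_mono (Ici_subset_Ici.2 hi)

lemma PtakProp.union {W : Type*} {A : ℕ → Set W} {D E : Set W} (hD : PtakProp A D)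
    (hE : PtakProp A E) : PtakProp A (D ∪ E) := by
  intro h hh δ hδ n
  have h1 := fun n => hD h hh δ hδ n
  choose g hg hgD using h1
  obtain ⟨k, hk, hkE⟩ := hE g (fun n => hull_trans hh n (hg n)) δ hδ n
  refine ⟨k, hull_trans hg n hk, ?_⟩
  rintro x (hx | hx)
  · have : convexHull ℝ (g '' Ici n) ⊆ {u : W → ℝ | u x ≤ δ} := by
      refine convexHull_min ?_ ?_
      · rintro _ ⟨i, _, rfl⟩
        exact hgD i x hx
      · intro u hu v hv a b ha hb hab
        simp only [mem_ofPred_eq, Pi.add_apply, Pi.smul_apply, smul_eq_mul] at *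
        nlinarith [mul_le_mul_of_nonneg_left hu ha, mul_le_mul_of_nonneg_left hv hb]
    exact this hk
  · exact hkE x hx

lemma PtakProp.biUnion {W : Type*} {A : ℕ → Set W} (F : Finset ℕ) (D : ℕ → Set W)
    (hD : ∀ i ∈ F, PtakProp A (D i)) : PtakProp A (⋃ i ∈ F, D i) := by
  classical
  induction F using Finset.induction_on with
  | empty => simpa using PtakProp.empty A
  | insert a s ha ih =>
    rw [Finset.set_biUnion_insert]
    exact (hD a (Finset.mem_insert_self _ _)).union
      (ih fun i hi => hD i (Finset.mem_insert_of_mem hi))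

lemma ptak_support {W : Type*} (A : ℕ → Set W) (n : ℕ) (g : W → ℝ)
    (hg : g ∈ convexHull ℝ ((fun i => (A i).indicator (fun _ => (1 : ℝ))) '' Ici n)) :
    (∀ x, g x ≤ 1) ∧ ∃ F : Finset ℕ, (∀ i ∈ F, n ≤ i) ∧ ∀ x, (∀ i ∈ F, x ∉ A i) → g x ≤ 0 := by
  classical
  have : convexHull ℝ ((fun i => (A i).indicator (fun _ => (1 : ℝ))) '' Ici n) ⊆
    {g | (∀ x, g x ≤ 1) ∧ ∃ F : Finset ℕ, (∀ i ∈ F, n ≤ i) ∧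
      ∀ x, (∀ i ∈ F, x ∉ A i) → g x ≤ 0} := by
    refine convexHull_min ?_ ?_
    · rintro _ ⟨i, hi, rfl⟩
      refine ⟨fun x => indicator_le_self' (by simp) x, {i}, by simpa using hi, fun x hx => ?_⟩
      simp only [Finset.mem_singleton, forall_eq] at hx
      simp [hx]
    · rintro u ⟨hu, F, hF, huF⟩ v ⟨hv, G, hG, hvG⟩ a b ha hb hab
      refine ⟨fun x => ?_, F ∪ G, ?_, fun x hx => ?_⟩
      · simp only [Pi.add_apply, Pi.smul_apply, smul_eq_mul]
        nlinarith [mul_le_mul_of_nonneg_left (hu x) ha, mul_le_mul_of_nonneg_left (hv x) hb]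
      · intro i hi
        rcases Finset.mem_union.1 hi with h | h
        · exact hF i h
        · exact hG i h
      · simp only [Pi.add_apply, Pi.smul_apply, smul_eq_mul]
        have h1 := huF x fun i hi => hx i (Finset.mem_union_left _ hi)
        have h2 := hvG x fun i hi => hx i (Finset.mem_union_right _ hi)
        nlinarith [mul_nonneg ha (neg_nonneg.2 h1), mul_nonneg hb (neg_nonneg.2 h2)]
  exact this hg

lemma PtakProp.step {W : Type*} {A : ℕ → Set W} {D : Set W} (n₀ : ℕ)
    (hD : ∀ k, n₀ ≤ k → PtakProp A (D ∩ A k)) : PtakProp A D := by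
  classical
  intro h hh δ hδ n'
  obtain ⟨n, hn', hn⟩ : ∃ n, n' ≤ n ∧ n₀ ≤ n := ⟨max n' n₀, le_max_left _ _, le_max_right _ _⟩
  have hsub : convexHull ℝ (h '' Ici n) ⊆ convexHull ℝ (h '' Ici n') :=
    convexHull_mono (image_mono (Ici_subset_Ici.2 hn'))
  have key : ∀ N : ℕ, ∃ a ∈ convexHull ℝ (h '' Ici n), ∃ F : Finset ℕ, (∀ i ∈ F, n ≤ i) ∧
      (∀ x ∈ D, ((N : ℝ) + 1) * a x ≤ 1 + (N + 1) * (δ / 2)) ∧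
      ∀ x, (∀ i ∈ F, x ∉ A i) → a x ≤ 0 := by
    intro N
    induction N with
    | zero =>
      have hm : h n ∈ convexHull ℝ (h '' Ici n) :=
        subset_convexHull ℝ _ ⟨n, mem_Ici.2 le_rfl, rfl⟩
      obtain ⟨h1, F, hF, hF0⟩ := ptak_support A n (h n) (hh n)
      refine ⟨h n, hm, F, hF, fun x _ => ?_, hF0⟩
      have := h1 x
      norm_num
      linarith
    | succ N ih =>
      obtain ⟨a, ha, F, hF, haD, haF⟩ := ih
      obtain ⟨g, hg, hgD⟩ := PtakProp.biUnion F (fun i => D ∩ A i)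
        (fun i hi => hD i (hn.trans (hF i hi))) h hh (δ / 2) (half_pos hδ) n
      obtain ⟨h1, G, hG, hG0⟩ := ptak_support A n g (hull_trans hh n hg)
      have hN : (0 : ℝ) < (N : ℝ) + 1 + 1 := by positivity
      refine ⟨(((N : ℝ) + 1) / (N + 1 + 1)) • a + (1 / ((N : ℝ) + 1 + 1)) • g,
        (convex_convexHull ℝ _) ha hg (by positivity) (by positivity) (by field_simp), F ∪ G,
        ?_, ?_, ?_⟩
      · intro i hi
        rcases Finset.mem_union.1 hi with h | h
        · exact hF i h
        · exact hG i h
      · intro x hx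
        have e1 : (((N + 1 : ℕ) : ℝ) + 1) *
          ((((N : ℝ) + 1) / (N + 1 + 1)) • a + (1 / ((N : ℝ) + 1 + 1)) • g) x =
            (N + 1) * a x + g x := by
          simp only [Pi.add_apply, Pi.smul_apply, smul_eq_mul]
          push_cast
          field_simp
        rw [e1]
        push_cast
        by_cases hxF : ∃ i ∈ F, x ∈ A i
        · obtain ⟨i, hi, hxi⟩ := hxF
          have h2 := hgD x (mem_iUnion₂.2 ⟨i, hi, hx, hxi⟩)
          have h3 := haD x hx
          linarith
        · push Not at hxF
          have h2 := haF x hxF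
          have h3 := h1 x
          have h4 : ((N : ℝ) + 1) * a x ≤ 0 :=
            mul_nonpos_of_nonneg_of_nonpos (by positivity) h2
          have h5 : 0 ≤ ((N : ℝ) + 1 + 1) * (δ / 2) := by positivity
          linarith
      · intro x hx
        simp only [Pi.add_apply, Pi.smul_apply, smul_eq_mul]
        have h1 := haF x fun i hi => hx i (Finset.mem_union_left _ hi)
        have h2 := hG0 x fun i hi => hx i (Finset.mem_union_right _ hi)
        have h3 : 0 ≤ ((N : ℝ) + 1) / (N + 1 + 1) := by positivity
        have h4 : 0 ≤ 1 / ((N : ℝ) + 1 + 1) := by positivity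
        nlinarith [mul_nonneg h3 (neg_nonneg.2 h1), mul_nonneg h4 (neg_nonneg.2 h2)]
  obtain ⟨N, hN⟩ := exists_nat_one_div_lt (half_pos hδ)
  obtain ⟨a, ha, F, hF, haD, haF⟩ := key N
  refine ⟨a, hsub ha, fun x hx => ?_⟩
  have h1 := haD x hx
  have hNp : (0 : ℝ) < (N : ℝ) + 1 := by positivity
  rw [div_lt_iff₀ hNp] at hN
  have : ((N : ℝ) + 1) * a x ≤ ((N : ℝ) + 1) * δ := by nlinarith
  exact le_of_mul_le_mul_left this hNp

lemma ptak {W : Type*} (A : ℕ → Set W)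
    (hcomp : ∀ k : ℕ → ℕ, (∀ n, ∃ x, ∀ i ≤ n, x ∈ A (k i)) → ∃ x, ∀ i, x ∈ A (k i))
    (hfin : ∀ x, ∃ N, ∀ i ≥ N, x ∉ A i) (δ : ℝ) (hδ : 0 < δ) :
    ∃ g ∈ convexHull ℝ (range (fun i => (A i).indicator (fun _ => (1 : ℝ)))), ∀ x, g x ≤ δ := by
  classical
  by_cases hP : PtakProp A univ
  · obtain ⟨g, hg, hgδ⟩ := hP (fun i => (A i).indicator (fun _ => (1 : ℝ)))
      (fun n => subset_convexHull ℝ _ ⟨n, mem_Ici.2 le_rfl, rfl⟩) δ hδ 0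
    exact ⟨g, convexHull_mono (image_subset_range _ _) hg, fun x => hgδ x (mem_univ x)⟩
  · exfalso
    have hst : ∀ (D : {D : Set W // ¬ PtakProp A D}) (n : ℕ), ∃ k, n ≤ k ∧
        ¬ PtakProp A (D.1 ∩ A k) := by
      intro D n
      by_contra hcon
      push Not at hcon
      exact D.2 (PtakProp.step n hcon)
    choose k hk hkP using hst
    let Ds : ℕ → {D : Set W // ¬ PtakProp A D} := fun n =>
      Nat.rec ⟨univ, hP⟩ (fun n D => ⟨D.1 ∩ A (k D n), hkP D n⟩) n
    have hDs : ∀ n, (Ds (n + 1)).1 = (Ds n).1 ∩ A (k (Ds n) n) := fun n => rfl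
    have hanti : Antitone fun n => (Ds n).1 :=
      antitone_nat_of_succ_le fun n => by rw [hDs n]; exact inter_subset_left
    obtain ⟨x, hx⟩ := hcomp (fun n => k (Ds n) n) (by
      intro n
      have hne : (Ds (n + 1)).1.Nonempty := by
        rw [nonempty_iff_ne_empty]
        intro he
        exact (Ds (n + 1)).2 (he ▸ PtakProp.empty A)
      obtain ⟨x, hx⟩ := hne
      refine ⟨x, fun i hi => ?_⟩
      have h1 := hanti (Nat.succ_le_succ hi) hx
      simp only [Nat.succ_eq_add_one, hDs i] at h1
      exact h1.2)
    obtain ⟨N, hN⟩ := hfin x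
    exact hN (k (Ds N) N) (hk _ _) (hx N)


/-- the segment `[-v, v]` -/
def segK {X : Type*} [NormedAddCommGroup X] [NormedSpace ℝ X] (v : X) : Set X :=
  (fun s : ℝ => s • v) '' Icc (-1) 1

open Pointwise in
lemma interior_or_hyperplane {X : Type*} [NormedAddCommGroup X] [NormedSpace ℝ X]
    (D : Set X) (hD : Convex ℝ D) (v : X) (hInt : (interior (D + segK v)).Nonempty) :
    (interior D).Nonempty ∨ ∃ (f : StrongDual ℝ X) (c : ℝ), f ≠ 0 ∧ ∀ d ∈ D, f d = c := by
  have hDne : D.Nonempty := by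
    obtain ⟨x, hx⟩ := hInt
    obtain ⟨d, hd, -⟩ := Set.mem_add.1 (interior_subset hx)
    exact ⟨d, hd⟩
  by_cases hcase : ∃ d ∈ D, ∃ t : ℝ, 0 < t ∧ d + t • v ∈ D
  · left
    obtain ⟨d, hd, t, ht, hdt⟩ := hcase
    set l : ℝ := t / (2 + t) with hl
    have hl0 : 0 < l := by positivity
    have hl1 : 1 - l = 2 / (2 + t) := by rw [hl]; field_simp; ring
    let w : X := l • v + (1 - l) • d
    let ψ : X → X := fun z => l⁻¹ • (z - w)
    have hψ : Continuous ψ := by fun_prop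
    have hsub : ψ ⁻¹' (interior (D + segK v)) ⊆ D := by
      intro z hz
      obtain ⟨d', hd', k, ⟨s, ⟨hs1, hs2⟩, rfl⟩, he⟩ := Set.mem_add.1 (interior_subset hz)
      have hz' : z = l • (d' + s • v) + w := by
        have : l • ψ z = z - w := by
          simp only [ψ]; rw [smul_smul, mul_inv_cancel₀ hl0.ne', one_smul]
        have he' : d' + s • v = ψ z := he
        rw [he', this]; abel
      have hmid : d + ((s + 1) / 2 * t) • v ∈ D := by
        have := hD hd hdt (a := 1 - (s + 1) / 2) (b := (s + 1) / 2) (by linarith) (by linarith)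
          (by ring)
        convert this using 1
        module
      have := hD hd' hmid (a := l) (b := 1 - l) hl0.le (by rw [hl1]; positivity) (by ring)
      have hc : (1 - l) * ((s + 1) / 2 * t) = l * (s + 1) := by
        rw [hl1, hl]; field_simp
      have e : z = l • d' + (1 - l) • (d + ((s + 1) / 2 * t) • v) := by
        rw [smul_add (1 - l), smul_smul, hc, hz']
        simp only [w]
        module
      rw [e]; exact this
    obtain ⟨e0, he0⟩ := hInt
    refine ⟨l • e0 + w, ?_⟩
    refine mem_interior.2 ⟨_, hsub, isOpen_interior.preimage hψ, ?_⟩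
    have : ψ (l • e0 + w) = e0 := by
      simp only [ψ, add_sub_cancel_right]
      rw [smul_smul, inv_mul_cancel₀ hl0.ne', one_smul]
    rw [mem_preimage, this]; exact he0
  · right
    push Not at hcase
    let S : Set X := D + (fun s : ℝ => s • v) '' Icc 0 2
    have hScv : Convex ℝ S := by
      refine hD.add ?_
      exact (convex_Icc (0 : ℝ) 2).linear_image (LinearMap.toSpanSingleton ℝ X v)
    have hSint : (interior S).Nonempty := by
      obtain ⟨e0, he0⟩ := hInt
      refine ⟨e0 + v, ?_⟩
      have hc : Continuous (fun z : X => z - v) := by fun_prop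
      refine mem_interior.2 ⟨(fun z : X => z - v) ⁻¹' (interior (D + segK v)), ?_,
        isOpen_interior.preimage hc, by simpa using he0⟩
      intro z hz
      obtain ⟨d', hd', k, ⟨s, ⟨hs1, hs2⟩, rfl⟩, he⟩ := Set.mem_add.1 (interior_subset hz)
      refine Set.mem_add.2 ⟨d', hd', (s + 1) • v, ⟨s + 1, ⟨by linarith, by linarith⟩, rfl⟩, ?_⟩
      have : z = (d' + s • v) + v := by
        have he' : d' + s • v = z - v := he
        rw [he']; abel
      rw [this]; module
    have hdisj : Disjoint (interior S) D := by
      rw [Set.disjoint_left]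
      intro d hdS hdD
      have hc : Tendsto (fun τ : ℝ => d - τ • v) (𝓝[>] 0) (𝓝 d) := by
        have : ContinuousAt (fun τ : ℝ => d - τ • v) 0 := by fun_prop
        have h2 := this.tendsto
        simp only [zero_smul, sub_zero] at h2
        exact h2.mono_left nhdsWithin_le_nhds
      have h1 : ∀ᶠ τ in 𝓝[>] (0 : ℝ), d - τ • v ∈ interior S :=
        hc (isOpen_interior.mem_nhds hdS)
      obtain ⟨τ, hτS, hτ⟩ := (h1.and self_mem_nhdsWithin).exists
      have hτ0 : 0 < τ := hτ
      obtain ⟨d', hd', k, ⟨s, ⟨hs1, hs2⟩, rfl⟩, he⟩ := Set.mem_add.1 (interior_subset hτS)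
      refine hcase d' hd' (s + τ) (by linarith) ?_
      have he' : d' + s • v = d - τ • v := he
      have : d' + (s + τ) • v = d := by
        rw [add_smul, ← add_assoc, he']; abel
      rw [this]; exact hdD
    obtain ⟨f, u, hf, hfS, hfD⟩ :=
      geometric_hahn_banach_of_nonempty_interior hScv hD hdisj hSint hDne
    refine ⟨f, u, hf, fun d hd => le_antisymm (hfS d ?_) (hfD d hd)⟩
    exact Set.mem_add.2 ⟨d, hd, 0, ⟨0, ⟨le_rfl, by norm_num⟩, by simp⟩, by simp⟩

lemma exists_far_point {X : Type*} [NormedAddCommGroup X] [NormedSpace ℝ X]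
    (S : Set X) (hS : Convex ℝ S) (hcl : IsClosed S) (hInt : interior S = ∅) (ε : ℝ)
    (hε : 0 < ε) : ∃ y : X, ‖y‖ ≤ ε ∧ ∀ s ∈ S, ε / 4 ≤ ‖y - s‖ := by
  rcases S.eq_empty_or_nonempty with rfl | ⟨s₀, hs₀⟩
  · exact ⟨0, by simpa using hε.le, by simp⟩
  have h1 : ∃ y₀ ∈ Metric.ball (0 : X) (ε / 2), y₀ ∉ S := by
    by_contra hcon
    push Not at hcon
    have : (0 : X) ∈ interior S :=
      mem_interior.2 ⟨_, hcon, Metric.isOpen_ball, Metric.mem_ball_self (by linarith)⟩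
    rw [hInt] at this
    exact this
  obtain ⟨y₀, hy₀, hy₀S⟩ := h1
  obtain ⟨f, u, hfS, hfy⟩ := geometric_hahn_banach_closed_point hS hcl hy₀S
  have hf : f ≠ 0 := by
    rintro rfl
    have := hfS s₀ hs₀
    simp at this hfy
    linarith
  have hfn : 0 < ‖f‖ := norm_pos_iff.2 hf
  obtain ⟨w, hw1, hw2⟩ := f.exists_lt_apply_of_lt_opNorm (r := ‖f‖ / 2) (by linarith)
  obtain ⟨z, hz1, hz2⟩ : ∃ z : X, ‖z‖ < 1 ∧ ‖f‖ / 2 < f z := by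
    rw [Real.norm_eq_abs] at hw2
    rcases lt_abs.1 hw2 with h | h
    · exact ⟨w, hw1, h⟩
    · exact ⟨-w, by simpa using hw1, by simpa using h⟩
  refine ⟨y₀ + (ε / 2) • z, ?_, fun s hs => ?_⟩
  · have h2 : ‖y₀‖ < ε / 2 := by simpa using hy₀
    have h3 : ‖(ε / 2) • z‖ ≤ ε / 2 := by
      rw [norm_smul, Real.norm_eq_abs, abs_of_pos (by linarith)]
      nlinarith
    linarith [norm_add_le y₀ ((ε / 2) • z)]
  · have h2 : f (y₀ + (ε / 2) • z - s) = f y₀ - f s + ε / 2 * f z := by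
      simp only [map_sub, map_add, map_smul, smul_eq_mul]; ring
    have h3 := hfS s hs
    have h4 : f (y₀ + (ε / 2) • z - s) ≤ ‖f‖ * ‖y₀ + (ε / 2) • z - s‖ :=
      (Real.le_norm_self _).trans (f.le_opNorm _)
    have h5 : ‖f‖ * (ε / 4) ≤ ‖f‖ * ‖y₀ + (ε / 2) • z - s‖ := by nlinarith
    exact le_of_mul_le_mul_left h5 hfn

open Pointwise in
lemma exists_escaping_seq {X : Type*} [NormedAddCommGroup X] [NormedSpace ℝ X]
    [TopologicalSpace.SeparableSpace X]
    (C : Set X) (hC : Convex ℝ C) (hcl : IsClosed C) (hInt : interior C = ∅)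
    (hhyp : ¬ ∃ (f : StrongDual ℝ X) (c : ℝ), f ≠ 0 ∧ ∀ d ∈ C, f d = c)
    (ε : ℝ) (hε : 0 < ε) :
    ∃ y : ℕ → X, (∀ i, ‖y i‖ ≤ ε) ∧ ∀ x, ∃ N, ∀ i ≥ N, x + y i ∉ C := by
  let d := TopologicalSpace.denseSeq X
  let B : ℕ → Set X := fun n => Nat.rec C (fun n S => S + segK (d n)) n
  have hB : ∀ n, B (n + 1) = B n + segK (d n) := fun n => rfl
  have hzero : ∀ v : X, (0 : X) ∈ segK v := fun v => ⟨0, by norm_num, by simp⟩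
  have hone : ∀ v : X, v ∈ segK v := fun v => ⟨1, by norm_num, by simp⟩
  have hmono : Monotone B := by
    refine monotone_nat_of_le_succ fun n x hx => ?_
    rw [hB]
    exact Set.mem_add.2 ⟨x, hx, 0, hzero _, by simp⟩
  have hprop : ∀ n, Convex ℝ (B n) ∧ IsClosed (B n) ∧ interior (B n) = ∅ := by
    intro n
    induction n with
    | zero => exact ⟨hC, hcl, hInt⟩
    | succ n ih =>
      obtain ⟨h1, h2, h3⟩ := ih
      rw [hB]
      refine ⟨h1.add ?_, ?_, ?_⟩
      · exact (convex_Icc (-1 : ℝ) 1).linear_image (LinearMap.toSpanSingleton ℝ X (d n))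
      · refine h2.add_right_of_isCompact ?_
        exact isCompact_Icc.image (by fun_prop)
      · by_contra hne
        rcases interior_or_hyperplane (B n) h1 (d n) (nonempty_iff_ne_empty.2 hne) with h | h
        · rw [h3] at h; exact not_nonempty_empty h
        · obtain ⟨f, c, hf, hfc⟩ := h
          exact hhyp ⟨f, c, hf, fun x hx => hfc x (hmono (Nat.zero_le n) hx)⟩
  have hy := fun n => exists_far_point (B n) (hprop n).1 (hprop n).2.1 (hprop n).2.2 ε hε
  choose y hy1 hy2 using hy
  refine ⟨y, hy1, fun x => ?_⟩
  obtain ⟨j, hj⟩ := (TopologicalSpace.denseRange_denseSeq X).exists_dist_lt (-x)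
    (show 0 < ε / 4 by linarith)
  refine ⟨j + 1, fun i hi hmem => ?_⟩
  have h1 : x + y i + d j ∈ B i := by
    refine hmono hi ?_
    rw [hB]
    exact Set.mem_add.2 ⟨x + y i, hmono (Nat.zero_le j) hmem, d j, hone _, rfl⟩
  have h2 := hy2 i _ h1
  have h3 : y i - (x + y i + d j) = -x - d j := by abel
  rw [h3, ← dist_eq_norm] at h2
  linarith

lemma matouskova_finite {X : Type*} [NormedAddCommGroup X] [NormedSpace ℝ X]
    [TopologicalSpace.SeparableSpace X] [MeasurableSpace X] [BorelSpace X]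
    (hrefl : IsReflexiveSpace X)
    (C : Set X) (hC : Convex ℝ C) (hcl : IsClosed C) (hInt : interior C = ∅)
    (hb : Bornology.IsBounded C)
    (ε : ℝ) (hε : 0 < ε) (δ : ℝ) (hδ : 0 < δ) :
    ∃ ν : Measure X, IsProbabilityMeasure ν ∧ ν (Metric.closedBall 0 ε)ᶜ = 0 ∧
      ∀ x, ν {y | x + y ∈ C} ≤ ENNReal.ofReal δ := by
  have hmeas : ∀ x, MeasurableSet {y | x + y ∈ C} := fun x =>
    (hcl.preimage (f := fun y => x + y) (by fun_prop)).measurableSet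
  have hbm : MeasurableSet ((Metric.closedBall (0 : X) ε)ᶜ) :=
    Metric.isClosed_closedBall.measurableSet.compl
  by_cases hhyp : ∃ (f : StrongDual ℝ X) (c : ℝ), f ≠ 0 ∧ ∀ d ∈ C, f d = c
  · obtain ⟨f, c, hf, hfc⟩ := hhyp
    obtain ⟨w, hw⟩ : ∃ w, f w ≠ 0 := by
      by_contra hcon
      push Not at hcon
      exact hf (ContinuousLinearMap.ext hcon)
    let u : X := (ε / (‖w‖ + 1)) • w
    have hwp : 0 < ‖w‖ + 1 := by positivity
    have hfu : f u ≠ 0 := by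
      simp only [u, map_smul, smul_eq_mul]
      exact mul_ne_zero (by positivity) hw
    have hu : ‖u‖ ≤ ε := by
      simp only [u, norm_smul, Real.norm_eq_abs]
      rw [abs_of_pos (by positivity), div_mul_eq_mul_div, div_le_iff₀ hwp]
      nlinarith [norm_nonneg w]
    have hm : Measurable (fun t : ℝ => t • u) := by fun_prop
    have hvp : IsProbabilityMeasure ((volume : Measure ℝ).restrict (Icc 0 1)) :=
      ⟨by simp⟩
    refine ⟨((volume : Measure ℝ).restrict (Icc 0 1)).map (fun t => t • u),
      Measure.isProbabilityMeasure_map hm.aemeasurable, ?_, fun x => ?_⟩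
    · rw [Measure.map_apply hm hbm, Measure.restrict_apply (hm hbm)]
      convert measure_empty (μ := (volume : Measure ℝ))
      rw [eq_empty_iff_forall_notMem]
      rintro t ⟨ht, ht0, ht1⟩
      apply ht
      simp only [Metric.mem_closedBall, dist_zero_right, norm_smul, Real.norm_eq_abs,
        abs_of_nonneg ht0]
      nlinarith [norm_nonneg u]
    · rw [Measure.map_apply hm (hmeas x)]
      refine le_trans (le_of_eq ?_) (zero_le)
      refine measure_mono_null (t := {(c - f x) / f u}) ?_ ?_
      · intro t ht
        have h1 := hfc _ ht
        simp only [map_add, map_smul, smul_eq_mul] at h1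
        rw [mem_singleton_iff, eq_div_iff hfu]
        linarith
      · exact le_antisymm ((Measure.restrict_apply_le _ _).trans (by simp)) (zero_le)
  · obtain ⟨y, hy, hesc⟩ := exists_escaping_seq C hC hcl hInt hhyp ε hε
    let A : ℕ → Set X := fun i => {x | x + y i ∈ C}
    have hAcl : ∀ i, IsClosed (A i) := fun i =>
      hcl.preimage (f := fun x => x + y i) (by fun_prop)
    have hAcv : ∀ i, Convex ℝ (A i) := fun i => hC.translate_preimage_left (y i)
    have hAb : ∀ i, Bornology.IsBounded (A i) := by
      intro i
      obtain ⟨R, hR⟩ := hb.exists_norm_le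
      refine isBounded_iff_forall_norm_le.2 ⟨R + ‖y i‖, fun x hx => ?_⟩
      have := hR _ hx
      have h2 : ‖x‖ ≤ ‖x + y i‖ + ‖y i‖ := by
        have := norm_sub_le (x + y i) (y i)
        simpa using this
      linarith
    obtain ⟨g, hg, hgδ⟩ := ptak A (by
      intro k hk
      have := nested_nonempty_of_reflexive hrefl (fun n => ⋂ i ≤ n, A (k i)) (by
          intro n x hx
          simp only [mem_iInter] at hx ⊢
          exact fun i hi => hx i (hi.trans (Nat.le_succ n)))
        (by
          intro n
          obtain ⟨x, hx⟩ := hk n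
          exact ⟨x, by simpa using hx⟩)
        (fun n => isClosed_iInter fun i => isClosed_iInter fun _ => hAcl _)
        (fun n => convex_iInter fun i => convex_iInter fun _ => hAcv _)
        ((hAb (k 0)).subset (by intro x hx; simpa using hx))
      obtain ⟨x, hx⟩ := this
      refine ⟨x, fun i => ?_⟩
      simp only [mem_iInter] at hx
      exact hx i i le_rfl) hesc δ hδ
    have hsub : convexHull ℝ (range (fun i => (A i).indicator (fun _ => (1 : ℝ)))) ⊆
        {g | (∀ x, 0 ≤ g x) ∧ ∃ ν : Measure X, IsProbabilityMeasure ν ∧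
          ν (Metric.closedBall 0 ε)ᶜ = 0 ∧ ∀ x, ν {y | x + y ∈ C} = ENNReal.ofReal (g x)} := by
      refine convexHull_min ?_ ?_
      · rintro _ ⟨i, rfl⟩
        refine ⟨fun x => indicator_nonneg (by simp) x, Measure.dirac (y i), inferInstance, ?_, ?_⟩
        · rw [Measure.dirac_apply' _ hbm]
          simp [hy i]
        · intro x
          rw [Measure.dirac_apply' _ (hmeas x)]
          by_cases hx : x + y i ∈ C
          · have hx' : x ∈ A i := hx
            simp [hx, hx']
          · have hx' : x ∉ A i := hx
            simp [hx, hx']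
      · rintro g₁ ⟨hg₁, ν₁, hp₁, hb₁, he₁⟩ g₂ ⟨hg₂, ν₂, hp₂, hb₂, he₂⟩ a b ha hb hab
        refine ⟨fun x => add_nonneg (mul_nonneg ha (hg₁ x)) (mul_nonneg hb (hg₂ x)),
          ENNReal.ofReal a • ν₁ + ENNReal.ofReal b • ν₂, ⟨?_⟩, ?_, fun x => ?_⟩
        · simp [← ENNReal.ofReal_add ha hb, hab]
        · simp [hb₁, hb₂]
        · simp only [Measure.add_apply, Measure.smul_apply, smul_eq_mul, he₁, he₂, Pi.add_apply,
            Pi.smul_apply]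
          rw [ENNReal.ofReal_add (mul_nonneg ha (hg₁ x)) (mul_nonneg hb (hg₂ x)),
            ENNReal.ofReal_mul ha, ENNReal.ofReal_mul hb]
    obtain ⟨-, ν, hp, hν, he⟩ := hsub hg
    refine ⟨ν, hp, hν, fun x => ?_⟩
    rw [he]
    exact ENNReal.ofReal_le_ofReal (hgδ x)


/-- null sets for a fixed measure and all translates, up to Borel hull -/
def NullFor {X : Type*} [AddCommGroup X] [MeasurableSpace X] (μ : Measure X) (E : Set X) : Prop :=
  ∃ B : Set X, E ⊆ B ∧ MeasurableSet B ∧ ∀ x : X, μ {y | x + y ∈ B} = 0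

lemma NullFor.mono {X : Type*} [AddCommGroup X] [MeasurableSpace X] {μ : Measure X}
    {E F : Set X} (hF : NullFor μ F) (h : E ⊆ F) : NullFor μ E := by
  obtain ⟨B, h1, h2, h3⟩ := hF
  exact ⟨B, h.trans h1, h2, h3⟩

lemma NullFor.iUnion {X : Type*} [AddCommGroup X] [MeasurableSpace X] {μ : Measure X}
    {ι : Type*} [Countable ι] {E : ι → Set X} (h : ∀ i, NullFor μ (E i)) :
    NullFor μ (⋃ i, E i) := by
  choose B h1 h2 h3 using h
  refine ⟨⋃ i, B i, iUnion_mono h1, MeasurableSet.iUnion h2, fun x => ?_⟩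
  have : {y | x + y ∈ ⋃ i, B i} = ⋃ i, {y | x + y ∈ B i} := by ext y; simp
  rw [this]
  exact measure_iUnion_null fun i => h3 i x

lemma NullFor.union {X : Type*} [AddCommGroup X] [MeasurableSpace X] {μ : Measure X}
    {E F : Set X} (hE : NullFor μ E) (hF : NullFor μ F) : NullFor μ (E ∪ F) := by
  rw [union_eq_iUnion]
  exact NullFor.iUnion (fun b => by cases b <;> assumption)

/-- `μ` vanishes on every Borel set which is null on all translates of some plane spanned by two
elements of `Q` -/
def GoodFor {X : Type*} [NormedAddCommGroup X] [NormedSpace ℝ X] [MeasurableSpace X]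
    (Q : AddSubgroup X) (μ : Measure X) : Prop :=
  ∀ p ∈ Q, ∀ q ∈ Q, ∀ B : Set X, MeasurableSet B →
    (∀ x : X, (volume : Measure (ℝ × ℝ)) {w | x + (w.1 • p + w.2 • q) ∈ B} = 0) →
    ∀ x : X, μ {y | x + y ∈ B} = 0

lemma GoodFor.line {X : Type*} [NormedAddCommGroup X] [NormedSpace ℝ X] [MeasurableSpace X]
    {Q : AddSubgroup X} {μ : Measure X} (h : GoodFor Q μ) {e : X} (he : e ∈ Q) {B : Set X}
    (hB : MeasurableSet B)
    (hv : ∀ x : X, (volume : Measure ℝ) {t | x + t • e ∈ B} = 0) :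
    ∀ x : X, μ {y | x + y ∈ B} = 0 := by
  refine h e he 0 Q.zero_mem B hB fun x => ?_
  have : {w : ℝ × ℝ | x + (w.1 • e + w.2 • (0 : X)) ∈ B} = {t | x + t • e ∈ B} ×ˢ univ := by
    ext w; simp
  rw [this, Measure.volume_eq_prod, Measure.prod_prod, hv x, zero_mul]

lemma exists_good_measure {X : Type*} [NormedAddCommGroup X] [NormedSpace ℝ X] [CompleteSpace X]
    [TopologicalSpace.SeparableSpace X] [MeasurableSpace X] [BorelSpace X]
    (hrefl : IsReflexiveSpace X) (Q : AddSubgroup X) (hQ : (Q : Set X).Countable)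
    (Z : Set X) (hZ : Convex ℝ Z) (hcl : IsClosed Z) (hInt : interior Z = ∅) :
    ∃ μ : Measure X, IsProbabilityMeasure μ ∧ GoodFor Q μ ∧ NullFor μ Z := by
  classical
  have : SecondCountableTopology X := UniformSpace.secondCountable_of_separable X
  have hQc : Countable Q := hQ.to_subtype
  have : Encodable ((Q × Q) ⊕ ℕ) := Encodable.ofCountable _
  obtain ⟨ε, hε, c, hc, -⟩ := posSumOfEncodable one_pos ((Q × Q) ⊕ ℕ)
  have hlin : ∀ (pq : Q × Q), ∃ ν : Measure X, IsProbabilityMeasure ν ∧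
      ν (Metric.closedBall 0 (ε (Sum.inl pq)))ᶜ = 0 ∧ ∀ B : Set X, MeasurableSet B →
      (∀ x : X, (volume : Measure (ℝ × ℝ)) {w | x + (w.1 • (pq.1 : X) + w.2 • (pq.2 : X)) ∈ B} = 0)
      → ∀ x : X, ν {y | x + y ∈ B} = 0 := by
    rintro ⟨⟨p, hp⟩, ⟨q, hq⟩⟩
    set η := ε (Sum.inl (⟨p, hp⟩, ⟨q, hq⟩)) with hη
    have hη0 : 0 < η := hε _
    let r : ℝ := η / (‖p‖ + ‖q‖ + 1)
    have hden : 0 < ‖p‖ + ‖q‖ + 1 := by positivity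
    have hr : 0 < r := by positivity
    let T : ℝ × ℝ → X := fun w => (r * w.1) • p + (r * w.2) • q
    have hT : Measurable T := by
      have : Continuous T := by fun_prop
      exact this.measurable
    let m0 : Measure (ℝ × ℝ) := (volume : Measure (ℝ × ℝ)).restrict (Icc 0 1 ×ˢ Icc 0 1)
    have hm0 : IsProbabilityMeasure m0 := ⟨by
      simp only [m0, Measure.restrict_apply_univ]
      rw [Measure.volume_eq_prod, Measure.prod_prod]; simp⟩
    refine ⟨m0.map T, Measure.isProbabilityMeasure_map hT.aemeasurable, ?_, fun B hB hvol x => ?_⟩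
    · have hbm : MeasurableSet ((Metric.closedBall (0 : X) η)ᶜ) :=
        Metric.isClosed_closedBall.measurableSet.compl
      rw [Measure.map_apply hT hbm, Measure.restrict_apply (hT hbm)]
      convert measure_empty (μ := (volume : Measure (ℝ × ℝ)))
      rw [eq_empty_iff_forall_notMem]
      rintro ⟨a, b⟩ ⟨hw, ⟨ha0, ha1⟩, hb0, hb1⟩
      apply hw
      simp only at ha0 ha1 hb0 hb1
      simp only [Metric.mem_closedBall, dist_zero_right, T]
      refine (norm_add_le _ _).trans ?_
      rw [norm_smul, norm_smul, Real.norm_eq_abs, Real.norm_eq_abs,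
        abs_of_nonneg (by positivity), abs_of_nonneg (by positivity)]
      have h1 : r * a * ‖p‖ ≤ r * ‖p‖ := by
        have : r * a ≤ r := by nlinarith
        exact mul_le_mul_of_nonneg_right this (norm_nonneg _)
      have h2 : r * b * ‖q‖ ≤ r * ‖q‖ := by
        have : r * b ≤ r := by nlinarith
        exact mul_le_mul_of_nonneg_right this (norm_nonneg _)
      have h3 : r * (‖p‖ + ‖q‖ + 1) = η := by simp only [r]; field_simp
      nlinarith
    · have hBx : MeasurableSet {y | x + y ∈ B} := (measurable_const_add x) hB
      rw [Measure.map_apply hT hBx]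
      refine le_antisymm ((Measure.restrict_apply_le _ _).trans ?_) zero_le
      have h1 := hvol x
      have h2 : T ⁻¹' {y | x + y ∈ B} =
          (fun w : ℝ × ℝ => r • w) ⁻¹' {w | x + (w.1 • p + w.2 • q) ∈ B} := by
        ext w; simp [T]
      rw [h2, Measure.addHaar_preimage_smul _ hr.ne']
      simp only at h1
      rw [h1, mul_zero]
  choose ν₁ hν₁ hb₁ hnull₁ using hlin
  have hmat : ∀ n : ℕ, ∃ ν : Measure X, IsProbabilityMeasure ν ∧
      ν (Metric.closedBall 0 (ε (Sum.inr n)))ᶜ = 0 ∧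
      ∀ x, ν {y | x + y ∈ Z ∩ Metric.closedBall 0 n} ≤ ENNReal.ofReal (1 / ((n : ℝ) + 1)) := by
    intro n
    refine matouskova_finite hrefl _ (hZ.inter (convex_closedBall _ _))
      (hcl.inter Metric.isClosed_closedBall) ?_ (Metric.isBounded_closedBall.subset inter_subset_right)
      _ (hε _) _ (by positivity)
    rw [interior_inter, hInt, empty_inter]
  choose ν₂ hν₂ hb₂ hnull₂ using hmat
  obtain ⟨μ, hμ, hconv⟩ := exists_prob_conv ε hc.summable (fun i => (hε i).le)
    (Sum.elim ν₁ ν₂) (by rintro (i | i); exacts [hν₁ i, hν₂ i])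
    (by rintro (i | i); exacts [hb₁ i, hb₂ i])
  refine ⟨μ, hμ, ?_, ?_⟩
  · intro p hp q hq B hB hvol x
    obtain ⟨ρ, hρ, hρB⟩ := hconv (Sum.inl (⟨p, hp⟩, ⟨q, hq⟩))
    rw [hρB {y | x + y ∈ B} ((measurable_const_add x) hB)]
    simp only [Sum.elim_inl]
    have : ∀ z, ν₁ (⟨p, hp⟩, ⟨q, hq⟩) {y | z + y ∈ {y | x + y ∈ B}} = 0 := by
      intro z
      have := hnull₁ (⟨p, hp⟩, ⟨q, hq⟩) B hB hvol (x + z)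
      simpa [add_assoc] using this
    exact (lintegral_congr this).trans lintegral_zero
  · have hZn : ∀ n : ℕ, NullFor μ (Z ∩ Metric.closedBall 0 n) := by
      intro n
      have hmz : ∀ k : ℕ, MeasurableSet (Z ∩ Metric.closedBall 0 (k : ℝ)) := fun k =>
        (hcl.inter Metric.isClosed_closedBall).measurableSet
      refine ⟨_, Subset.rfl, hmz n, fun x => ?_⟩
      have hle : ∀ k : ℕ, n ≤ k → μ {y | x + y ∈ Z ∩ Metric.closedBall 0 (n : ℝ)} ≤
          ENNReal.ofReal (1 / ((k : ℝ) + 1)) := by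
        intro k hk
        obtain ⟨ρ, hρ, hρB⟩ := hconv (Sum.inr k)
        have hsub : {y | x + y ∈ Z ∩ Metric.closedBall 0 (n : ℝ)} ⊆
          {y | x + y ∈ Z ∩ Metric.closedBall 0 (k : ℝ)} := by
          intro y hy
          exact ⟨hy.1, Metric.closedBall_subset_closedBall (by exact_mod_cast hk) hy.2⟩
        refine (measure_mono hsub).trans ?_
        rw [hρB {y | x + y ∈ Z ∩ Metric.closedBall 0 (k : ℝ)} ((measurable_const_add x) (hmz k))]
        simp only [Sum.elim_inr]
        calc ∫⁻ z, ν₂ k {y | z + y ∈ {y | x + y ∈ Z ∩ Metric.closedBall 0 (k : ℝ)}} ∂ρ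
            ≤ ∫⁻ _, ENNReal.ofReal (1 / ((k : ℝ) + 1)) ∂ρ := by
              refine lintegral_mono fun z => ?_
              have := hnull₂ k (x + z)
              simpa [add_assoc] using this
          _ = ENNReal.ofReal (1 / ((k : ℝ) + 1)) := by simp
      have hlim : Tendsto (fun k : ℕ => ENNReal.ofReal (1 / ((k : ℝ) + 1))) atTop (𝓝 0) := by
        have := ENNReal.tendsto_ofReal (tendsto_one_div_add_atTop_nhds_zero_nat (𝕜 := ℝ))
        simpa using this
      refine le_antisymm (ge_of_tendsto hlim ?_) zero_le
      filter_upwards [eventually_ge_atTop n] with k hk using hle k hk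
    refine (NullFor.iUnion hZn).mono fun z hz => ?_
    obtain ⟨n, hn⟩ := exists_nat_ge ‖z‖
    exact mem_iUnion.2 ⟨n, hz, by simpa using hn⟩

/-- exceptional set for a Lipschitz function -/
def badSet {X : Type*} [NormedAddCommGroup X] [NormedSpace ℝ X]
    (Q : AddSubgroup X) (u : X → ℝ) : Set X :=
  {x | ∃ p ∈ Q, ∃ q ∈ Q,
    ¬ DifferentiableAt ℝ (fun w : ℝ × ℝ => u (x + (w.1 • p + w.2 • q))) 0}

lemma badSet_null {X : Type*} [NormedAddCommGroup X] [NormedSpace ℝ X]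
    [TopologicalSpace.SeparableSpace X] [MeasurableSpace X] [BorelSpace X]
    {Q : AddSubgroup X} (hQ : (Q : Set X).Countable) {μ : Measure X} (hμ : GoodFor Q μ)
    {u : X → ℝ} {K : NNReal} (hu : LipschitzWith K u) : NullFor μ (badSet Q u) := by
  have : SecondCountableTopology X := UniformSpace.secondCountable_of_separable X
  have hQc : Countable Q := hQ.to_subtype
  have h1 : ∀ pq : Q × Q, NullFor μ
      {x | ¬ DifferentiableAt ℝ
        (fun w : ℝ × ℝ => u (x + (w.1 • (pq.1 : X) + w.2 • (pq.2 : X)))) 0} := by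
    rintro ⟨⟨p, hp⟩, ⟨q, hq⟩⟩
    simp only
    have hmeas : MeasurableSet {x | ¬ DifferentiableAt ℝ
        (fun w : ℝ × ℝ => u (x + (w.1 • p + w.2 • q))) 0} := by
      let G : X → (ℝ × ℝ) → ℝ := fun x w => u (x + (w.1 • p + w.2 • q))
      have hG : Continuous (Function.uncurry G) := by
        refine hu.continuous.comp ?_
        fun_prop
      have := measurableSet_of_differentiableAt_with_param ℝ hG
      have h2 : Measurable (fun x : X => (x, (0 : ℝ × ℝ))) := measurable_id.prodMk measurable_const
      exact (h2 this).compl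
    refine ⟨_, Subset.rfl, hmeas, ?_⟩
    refine hμ p hp q hq _ hmeas fun x => ?_
    let L : ℝ × ℝ →L[ℝ] X := (ContinuousLinearMap.fst ℝ ℝ ℝ).smulRight p +
      (ContinuousLinearMap.snd ℝ ℝ ℝ).smulRight q
    let G : ℝ × ℝ → ℝ := fun w => u (x + L w)
    have hG : LipschitzWith (K * (0 + ‖L‖₊)) G := by
      have h3 : LipschitzWith (0 + ‖L‖₊) (fun w => x + L w) :=
        (LipschitzWith.const x).add L.lipschitz
      exact hu.comp h3
    have hae := hG.ae_differentiableAt (μ := (volume : Measure (ℝ × ℝ)))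
    rw [ae_iff] at hae
    refine measure_mono_null ?_ hae
    intro w hw hdiff
    apply hw
    have hdiff' : DifferentiableAt ℝ G (w + 0) := by simpa using hdiff
    have h4 : DifferentiableAt ℝ (fun v : ℝ × ℝ => G (w + v)) 0 :=
      DifferentiableAt.comp (g := G) (f := fun v : ℝ × ℝ => w + v) 0 hdiff' (by fun_prop)
    convert h4 using 2 with v
    simp only [G, L, add_apply, ContinuousLinearMap.smulRight_apply,
      ContinuousLinearMap.coe_fst', ContinuousLinearMap.coe_snd', Prod.fst_add, Prod.snd_add]
    congr 1
    module
  refine (NullFor.iUnion h1).mono ?_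
  rintro x ⟨p, hp, q, hq, hx⟩
  exact mem_iUnion.2 ⟨(⟨p, hp⟩, ⟨q, hq⟩), hx⟩

lemma tendsto_quot_of_not_badSet {X : Type*} [NormedAddCommGroup X] [NormedSpace ℝ X]
    {Q : AddSubgroup X} {u : X → ℝ} {x : X} (hx : x ∉ badSet Q u) {p q : X} (hp : p ∈ Q)
    (hq : q ∈ Q) : ∃ a b : ℝ,
      Tendsto (fun t : ℝ => (u (x + t • p) - u x) / t) (𝓝[≠] 0) (𝓝 a) ∧
      Tendsto (fun t : ℝ => (u (x + t • q) - u x) / t) (𝓝[≠] 0) (𝓝 b) ∧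
      Tendsto (fun t : ℝ => (u (x + t • (p + q)) - u x) / t) (𝓝[≠] 0) (𝓝 (a + b)) := by
  have h : DifferentiableAt ℝ (fun w : ℝ × ℝ => u (x + (w.1 • p + w.2 • q))) 0 := by
    by_contra hc
    exact hx ⟨p, hp, q, hq, hc⟩
  obtain ⟨A, hA⟩ := h
  have key : ∀ c d : ℝ, Tendsto (fun t : ℝ => (u (x + t • (c • p + d • q)) - u x) / t)
      (𝓝[≠] 0) (𝓝 (A (c, d))) := by
    intro c d
    have h1 := hA.hasLineDerivAt (c, d)
    have h2 := hasDerivAt_iff_tendsto_slope_zero.1 h1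
    refine h2.congr fun t => ?_
    simp only [zero_add, zero_smul, Prod.smul_fst, Prod.smul_snd, smul_eq_mul, smul_add, smul_smul,
      Prod.fst_zero, Prod.snd_zero, add_zero]
    rw [div_eq_inv_mul]
  refine ⟨A (1, 0), A (0, 1), ?_, ?_, ?_⟩
  · simpa using key 1 0
  · simpa using key 0 1
  · have := key 1 1
    have h3 : A (1, 1) = A (1, 0) + A (0, 1) := by rw [← map_add]; simp
    rw [h3] at this
    simpa using this

lemma hadamard_of_not_badSet {X : Type*} [NormedAddCommGroup X] [NormedSpace ℝ X]
    {Q : AddSubgroup X} (hQd : Dense (Q : Set X)) {u : X → ℝ} {K : NNReal}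
    (hu : LipschitzWith K u) {x : X} (hx : x ∉ badSet Q u) : HadamardDiffAt u x := by
  have q1 : ∀ t : ℝ, t ≠ 0 → ∀ h h' : X,
      |(u (x + t • h) - u x) / t - (u (x + t • h') - u x) / t| ≤ K * ‖h - h'‖ := by
    intro t ht h h'
    have h1 := hu.dist_le_mul (x + t • h) (x + t • h')
    rw [Real.dist_eq, dist_eq_norm, add_sub_add_left_eq_sub, ← smul_sub, norm_smul,
      Real.norm_eq_abs] at h1
    rw [← sub_div, sub_sub_sub_cancel_right, abs_div, div_le_iff₀ (abs_pos.2 ht)]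
    linarith
  have q3 : ∀ h : X, ∃ a : ℝ,
      Tendsto (fun t : ℝ => (u (x + t • h) - u x) / t) (𝓝[≠] 0) (𝓝 a) := by
    intro h
    rw [← cauchy_map_iff_exists_tendsto, Metric.cauchy_iff]
    refine ⟨inferInstance, fun ε hε => ?_⟩
    have hK : (0 : ℝ) ≤ K := K.2
    obtain ⟨q, hq, hqh⟩ := hQd.exists_dist_lt h (show 0 < ε / (4 * (K + 1)) by positivity)
    obtain ⟨a, -, ha, -⟩ := tendsto_quot_of_not_badSet hx hq hq
    have h4 : K * ‖h - q‖ ≤ ε / 4 := by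
      rw [dist_eq_norm] at hqh
      rw [lt_div_iff₀ (by positivity)] at hqh
      nlinarith [norm_nonneg (h - q)]
    have h5 : ∀ᶠ t in 𝓝[≠] (0 : ℝ), |(u (x + t • h) - u x) / t - a| < ε / 2 := by
      filter_upwards [Metric.tendsto_nhds.1 ha (ε / 4) (by positivity), self_mem_nhdsWithin]
        with t ht ht0
      have h6 := q1 t ht0 h q
      rw [Real.dist_eq] at ht
      have := abs_sub_le ((u (x + t • h) - u x) / t) ((u (x + t • q) - u x) / t) a
      linarith
    refine ⟨_, image_mem_map h5, ?_⟩
    rintro _ ⟨t, ht, rfl⟩ _ ⟨s, hs, rfl⟩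
    simp only [mem_ofPred_eq] at ht hs
    rw [Real.dist_eq]
    have := abs_sub_le ((u (x + t • h) - u x) / t) a ((u (x + s • h) - u x) / s)
    rw [abs_sub_comm a] at this
    linarith
  choose D hD using q3
  have hDL : LipschitzWith K D := by
    refine LipschitzWith.of_dist_le_mul fun h h' => ?_
    rw [Real.dist_eq, dist_eq_norm]
    refine le_of_tendsto ((hD h).sub (hD h')).abs ?_
    filter_upwards [self_mem_nhdsWithin] with t ht
    exact q1 t ht h h'
  have hDc := hDL.continuous
  have hadd : ∀ h h' : X, D (h + h') = D h + D h' := by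
    have : (fun w : X × X => D (w.1 + w.2)) = fun w : X × X => D w.1 + D w.2 := by
      refine Continuous.ext_on (hQd.prod hQd) (by fun_prop) (by fun_prop) ?_
      rintro ⟨p, q⟩ ⟨hp, hq⟩
      obtain ⟨a, b, ha, hb, hab⟩ := tendsto_quot_of_not_badSet hx hp hq
      simp only
      rw [tendsto_nhds_unique (hD p) ha, tendsto_nhds_unique (hD q) hb,
        tendsto_nhds_unique (hD (p + q)) hab]
    exact fun h h' => congrFun this (h, h')
  refine ⟨(AddMonoidHom.mk' D hadd).toRealLinearMap hDc, fun h t ht ht0 hs hhs => ?_⟩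
  have h1 : Tendsto (fun n => (u (x + t n • h) - u x) / t n) atTop (𝓝 (D h)) :=
    (hD h).comp (tendsto_nhdsWithin_iff.2 ⟨ht0, Eventually.of_forall ht⟩)
  have h2 : Tendsto (fun n => (K : ℝ) * ‖hs n - h‖) atTop (𝓝 0) := by
    have := (tendsto_iff_norm_sub_tendsto_zero.1 hhs).const_mul (K : ℝ)
    simpa using this
  have h3 : Tendsto (fun n => (u (x + t n • hs n) - u x) / t n - (u (x + t n • h) - u x) / t n)
      atTop (𝓝 0) :=
    squeeze_zero_norm (fun n => q1 (t n) (ht n) (hs n) h) h2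
  have h4 := h3.add h1
  simp only [sub_add_cancel, zero_add] at h4
  exact h4

/-- infimal convolution with `n * norm` -/
noncomputable def infConv {X : Type*} [NormedAddCommGroup X] (F : X → ℝ) (N : NNReal) (x : X) : ℝ :=
  ⨅ y, (F y + N * ‖x - y‖)

lemma infConv_bdd {X : Type*} [NormedAddCommGroup X] {F : X → ℝ} {M : ℝ} (hM : ∀ x, |F x| ≤ M)
    (N : NNReal) (x : X) : BddBelow (range fun y => F y + N * ‖x - y‖) := by
  refine ⟨-M, ?_⟩
  rintro _ ⟨y, rfl⟩
  have h1 := (abs_le.1 (hM y)).1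
  have h2 : (0 : ℝ) ≤ N * ‖x - y‖ := by positivity
  simp only
  linarith

lemma infConv_le {X : Type*} [NormedAddCommGroup X] {F : X → ℝ} {M : ℝ} (hM : ∀ x, |F x| ≤ M)
    (N : NNReal) (x : X) : infConv F N x ≤ F x := by
  have := ciInf_le (infConv_bdd hM N x) x
  simpa [infConv] using this

lemma infConv_eq {X : Type*} [NormedAddCommGroup X] {F : X → ℝ} {M : ℝ} (hM : ∀ x, |F x| ≤ M)
    (N : NNReal) (x : X) (h : ∀ y, F x - N * ‖x - y‖ ≤ F y) : infConv F N x = F x := by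
  refine le_antisymm (infConv_le hM N x) (le_ciInf fun y => ?_)
  linarith [h y]

lemma infConv_lipschitz {X : Type*} [NormedAddCommGroup X] {F : X → ℝ} {M : ℝ}
    (hM : ∀ x, |F x| ≤ M) (N : NNReal) : LipschitzWith N (infConv F N) := by
  refine LipschitzWith.of_le_add_mul _ fun x y => ?_
  have : infConv F N x - N * dist x y ≤ infConv F N y := by
    refine le_ciInf fun z => ?_
    have h1 := ciInf_le (infConv_bdd hM N x) z
    have h2 := norm_sub_le_norm_sub_add_norm_sub x y z
    have h3 : (N : ℝ) * ‖x - z‖ ≤ N * (‖x - y‖ + ‖y - z‖) := by gcongr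
    rw [dist_eq_norm]
    simp only [infConv] at *
    linarith
  linarith

lemma hadamard_squeeze {X : Type*} [NormedAddCommGroup X] [NormedSpace ℝ X] {F u v : X → ℝ} {x : X}
    (hu : HadamardDiffAt u x) (hv : HadamardDiffAt v x) (huF : ∀ y, u y ≤ F y) (hFv : ∀ y, F y ≤ v y)
    (hux : u x = F x) (hvx : v x = F x) : HadamardDiffAt F x := by
  obtain ⟨L, hL⟩ := hu
  obtain ⟨L', hL'⟩ := hv
  have hle : ∀ h, L h ≤ L' h := by
    intro h
    have ht : ∀ n : ℕ, (1 : ℝ) / (n + 1) ≠ 0 := fun n => by positivity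
    refine le_of_tendsto_of_tendsto'
      (hL h (fun n : ℕ => 1 / ((n : ℝ) + 1)) ht tendsto_one_div_add_atTop_nhds_zero_nat
        (fun _ => h) tendsto_const_nhds)
      (hL' h (fun n : ℕ => 1 / ((n : ℝ) + 1)) ht tendsto_one_div_add_atTop_nhds_zero_nat
        (fun _ => h) tendsto_const_nhds) fun n => ?_
    refine div_le_div_of_nonneg_right ?_ (by positivity)
    rw [hux, hvx]
    linarith [huF (x + (1 / ((n : ℝ) + 1)) • h), hFv (x + (1 / ((n : ℝ) + 1)) • h)]
  have heq : ∀ h, L h = L' h := fun h => le_antisymm (hle h) (by simpa using hle (-h))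
  refine ⟨L, fun h t ht ht0 hs hhs => ?_⟩
  have h1 := hL h t ht ht0 hs hhs
  have h2 := hL' h t ht ht0 hs hhs
  rw [← heq] at h2
  have h3 := h2.sub h1
  rw [sub_self] at h3
  have h3 := h3.abs
  rw [abs_zero] at h3
  have h4 : Tendsto (fun n => (F (x + t n • hs n) - F x) / t n - (u (x + t n • hs n) - u x) / t n)
      atTop (𝓝 0) := by
    refine squeeze_zero_norm (fun n => ?_) h3
    rw [Real.norm_eq_abs, ← sub_div, ← sub_div, abs_div, abs_div, hux, hvx,
      sub_sub_sub_cancel_right, sub_sub_sub_cancel_right]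
    have h5 := huF (x + t n • hs n)
    have h6 := hFv (x + t n • hs n)
    refine div_le_div_of_nonneg_right (abs_le_abs_of_nonneg ?_ ?_) (abs_nonneg _) <;> linarith
  have h5 := h4.add h1
  simpa using h5

lemma mono_jump_null {X : Type*} [NormedAddCommGroup X] [NormedSpace ℝ X]
    [MeasurableSpace X] [BorelSpace X]
    {Q : AddSubgroup X} {μ : Measure X} (hμ : GoodFor Q μ)
    {F : X → ℝ} {e : X} (he : e ∈ Q) (hmono : ∀ x, Monotone fun t : ℝ => F (x + t • e)) :
    NullFor μ (⋂ n : ℕ, ⋃ t ∈ Ioc (0 : ℝ) (1 / (n + 1)),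
      interior {u : X | ((n : ℝ) + 1) * t < F (u + (2 * t) • e) - F (u - (2 * t) • e)}) := by
  refine ⟨_, Subset.rfl, ?_, ?_⟩
  · refine MeasurableSet.iInter fun n => IsOpen.measurableSet ?_
    exact isOpen_biUnion fun t _ => isOpen_interior
  · refine hμ.line he ?_ fun x => ?_
    · refine MeasurableSet.iInter fun n => IsOpen.measurableSet ?_
      exact isOpen_biUnion fun t _ => isOpen_interior
    have hae := (hmono x).ae_differentiableAt
    rw [ae_iff] at hae
    refine measure_mono_null (fun τ hτ => ?_) hae
    intro hdiff
    obtain ⟨C, hC⟩ := hdiff.isBigO_sub.bound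
    obtain ⟨δ, hδ, hball⟩ := Metric.eventually_nhds_iff.1 hC
    obtain ⟨n, hn⟩ := exists_nat_gt (max (4 * C) (2 / δ))
    simp only [mem_ofPred_eq, mem_iInter, mem_iUnion] at hτ
    obtain ⟨t, ht, hu⟩ := hτ n
    have hu := interior_subset hu
    simp only [mem_ofPred_eq] at hu
    have hn1 : 4 * C < n := (le_max_left _ _).trans_lt hn
    have hn2 : 2 / δ < n := (le_max_right _ _).trans_lt hn
    rw [div_lt_iff₀ hδ] at hn2
    have ht1 : t * (n + 1) ≤ 1 := by
      have := ht.2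
      rwa [le_div_iff₀ (by positivity)] at this
    have ht0 : 0 < t := ht.1
    have ht2 : 2 * t < δ := by
      by_contra hc
      push Not at hc
      have : (n : ℝ) * δ ≤ n * (2 * t) := by gcongr
      nlinarith
    have h1 := hball (y := τ + 2 * t) (by simp [abs_of_pos ht0, ht2])
    have h2 := hball (y := τ - 2 * t) (by simp [abs_of_pos ht0, ht2])
    simp only [add_sub_cancel_left, sub_sub_cancel_left, norm_neg, Real.norm_eq_abs] at h1 h2
    rw [abs_of_pos (by positivity : 0 < 2 * t)] at h1 h2
    have e1 : x + τ • e + (2 * t) • e = x + (τ + 2 * t) • e := by module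
    have e2 : x + τ • e - (2 * t) • e = x + (τ - 2 * t) • e := by module
    rw [e1, e2] at hu
    have h3 := (abs_le.1 h1).2
    have h4 := (abs_le.1 h2).1
    nlinarith

lemma cone_point {X : Type*} [NormedAddCommGroup X] [NormedSpace ℝ X]
    {F : X → ℝ} {M : ℝ} (hM : ∀ x, |F x| ≤ M) {e : X} {s : ℝ} (hs : 0 < s)
    (hmono : ∀ (u k : X) (t : ℝ), 0 ≤ t → ‖k - t • e‖ ≤ t * s → F u ≤ F (u + k)) {x : X}
    (hx : x ∉ (⋂ n : ℕ, ⋃ t ∈ Ioc (0 : ℝ) (1 / (n + 1)),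
      interior {u : X | ((n : ℝ) + 1) * t < F (u + (2 * t) • e) - F (u - (2 * t) • e)})) :
    ∃ N : ℕ, ∀ y, |F y - F x| ≤ N * ‖x - y‖ := by
  have hmono' : ∀ (u v : X) (t : ℝ), 0 ≤ t → ‖v - u - t • e‖ ≤ t * s → F u ≤ F v := by
    intro u v t ht h
    have := hmono u (v - u) t ht h
    rwa [add_sub_cancel] at this
  simp only [mem_iInter, mem_iUnion, not_forall, not_exists] at hx
  obtain ⟨n, hn⟩ := hx
  have h1 : ∀ t : ℝ, 0 < t → t ≤ 1 / (n + 1) → F (x + t • e) - F (x - t • e) ≤ (n + 1) * t := by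
    intro t ht ht'
    by_contra hc
    push Not at hc
    refine hn t ⟨ht, ht'⟩ ?_
    rw [mem_interior]
    refine ⟨Metric.ball x (t * s), fun y hy => ?_, Metric.isOpen_ball,
      Metric.mem_ball_self (by positivity)⟩
    rw [Metric.mem_ball, dist_eq_norm] at hy
    have h2 : F (x + t • e) ≤ F (y + (2 * t) • e) := by
      refine hmono' _ _ t ht.le ?_
      have : y + (2 * t) • e - (x + t • e) - t • e = y - x := by module
      rw [this]
      exact hy.le
    have h3 : F (y - (2 * t) • e) ≤ F (x - t • e) := by
      refine hmono' _ _ t ht.le ?_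
      have : x - t • e - (y - (2 * t) • e) - t • e = x - y := by module
      rw [this, norm_sub_rev]
      exact hy.le
    simp only [mem_ofPred_eq]
    linarith
  have hM0 : 0 ≤ M := (abs_nonneg _).trans (hM x)
  obtain ⟨N, hN⟩ := exists_nat_gt ((2 * M + 1) * ((n + 1) / s))
  refine ⟨N, fun y => ?_⟩
  have hNle : (2 * M + 1) * ((n + 1) / s) * ‖x - y‖ ≤ N * ‖x - y‖ := by gcongr
  refine le_trans ?_ hNle
  rcases eq_or_ne x y with rfl | hxy
  · simp
  have hpos : 0 < ‖x - y‖ := norm_pos_iff.2 (sub_ne_zero.2 hxy)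
  have ha0 : 0 < ((n : ℝ) + 1) / s * ‖x - y‖ := by positivity
  by_cases hc : ‖x - y‖ / s ≤ 1 / (n + 1)
  · have ht : 0 < ‖x - y‖ / s := by positivity
    have hts : ‖x - y‖ / s * s = ‖x - y‖ := by field_simp
    have h2 := h1 _ ht hc
    generalize ‖x - y‖ / s = t at *
    have a1 : F (x - t • e) ≤ F x := by
      refine hmono' _ _ t ht.le ?_
      have : x - (x - t • e) - t • e = 0 := by module
      rw [this, norm_zero]; positivity
    have a2 : F x ≤ F (x + t • e) := by
      refine hmono' _ _ t ht.le ?_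
      have : (x + t • e) - x - t • e = 0 := by module
      rw [this, norm_zero]; positivity
    have a3 : F (x - t • e) ≤ F y := by
      refine hmono' _ _ t ht.le ?_
      have : y - (x - t • e) - t • e = y - x := by module
      rw [this, hts, norm_sub_rev]
    have a4 : F y ≤ F (x + t • e) := by
      refine hmono' _ _ t ht.le ?_
      have : (x + t • e) - y - t • e = x - y := by module
      rw [this, hts]
    have a5 : ((n : ℝ) + 1) * t = (n + 1) / s * ‖x - y‖ := by rw [← hts]; field_simp
    rw [a5] at h2
    rw [abs_le]
    constructor <;> nlinarith
  · push Not at hc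
    have hc' : 1 < (n + 1) / s * ‖x - y‖ := by
      rw [div_lt_iff₀ (by positivity)] at hc
      calc 1 < ‖x - y‖ / s * (n + 1) := hc
        _ = _ := by ring
    have b1 := abs_le.1 (hM x)
    have b2 := abs_le.1 (hM y)
    have b3 : |F y - F x| ≤ 2 * M := by rw [abs_le]; constructor <;> linarith
    nlinarith

lemma cone_mono_null {X : Type*} [NormedAddCommGroup X] [NormedSpace ℝ X]
    [TopologicalSpace.SeparableSpace X] [MeasurableSpace X] [BorelSpace X]
    {Q : AddSubgroup X} (hQ : (Q : Set X).Countable) (hQd : Dense (Q : Set X))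
    {μ : Measure X} (hμ : GoodFor Q μ)
    {F : X → ℝ} {M : ℝ} (hM : ∀ x, |F x| ≤ M) {e : X} (he : e ∈ Q) {s : ℝ} (hs : 0 < s)
    (hmono : ∀ (u k : X) (t : ℝ), 0 ≤ t → ‖k - t • e‖ ≤ t * s → F u ≤ F (u + k)) :
    NullFor μ {x | ¬ HadamardDiffAt F x} := by
  have hM' : ∀ x, |(fun y => - F y) x| ≤ M := fun x => by simpa using hM x
  have h1 := mono_jump_null hμ (F := F) he (fun x a b hab => by
    have := hmono (x + a • e) ((b - a) • e) (b - a) (sub_nonneg.2 hab)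
      (by rw [sub_self, norm_zero]; exact mul_nonneg (sub_nonneg.2 hab) hs.le)
    have e1 : x + a • e + (b - a) • e = x + b • e := by module
    rwa [e1] at this)
  have h2 : NullFor μ (⋃ N : ℕ, badSet Q (infConv F N)) :=
    NullFor.iUnion fun N => badSet_null hQ hμ (infConv_lipschitz hM N)
  have h3 : NullFor μ (⋃ N : ℕ, badSet Q (fun x => - infConv (fun y => - F y) N x)) :=
    NullFor.iUnion fun N => badSet_null hQ hμ (infConv_lipschitz hM' N).neg
  refine (h1.union (h2.union h3)).mono fun x hx => ?_
  by_contra hc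
  simp only [mem_union, not_or] at hc
  obtain ⟨c1, c2, c3⟩ := hc
  obtain ⟨N, hN⟩ := cone_point hM hs hmono c1
  simp only [mem_iUnion, not_exists] at c2 c3
  apply hx
  refine hadamard_squeeze (hadamard_of_not_badSet hQd (infConv_lipschitz hM N) (c2 N))
    (hadamard_of_not_badSet hQd (infConv_lipschitz hM' N).neg (c3 N))
    (fun y => infConv_le hM N y) (fun y => ?_) ?_ ?_
  · have := infConv_le hM' N y
    simp only [Pi.neg_apply]
    linarith
  · refine infConv_eq hM N x fun y => ?_
    have := (abs_le.1 (hN y)).1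
    simp only [NNReal.coe_natCast]
    linarith
  · have := infConv_eq hM' N x fun y => by
      have := (abs_le.1 (hN y)).2
      simp only [NNReal.coe_natCast]
      linarith
    simp only [Pi.neg_apply]
    linarith

lemma frontier_null {X : Type*} [NormedAddCommGroup X] [NormedSpace ℝ X]
    [MeasurableSpace X] [BorelSpace X]
    {Q : AddSubgroup X} (hQ : (Q : Set X).Countable) (hQd : Dense (Q : Set X))
    {μ : Measure X} (hμ : GoodFor Q μ) {D : Set X} (hD : Convex ℝ D)
    (hi : (interior D).Nonempty) : NullFor μ (frontier D) := by
  have hQc : Countable Q := hQ.to_subtype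
  have h1 : ∀ q : Q, NullFor μ {x | x ∈ frontier D ∧ x + (q : X) ∈ interior D} := by
    intro q
    have hm : MeasurableSet {x | x ∈ frontier D ∧ x + (q : X) ∈ interior D} :=
      isClosed_frontier.measurableSet.inter
        (isOpen_interior.preimage (continuous_add_const (q : X))).measurableSet
    refine ⟨_, Subset.rfl, hm, hμ.line q.2 hm fun x => Set.Countable.measure_zero ?_ _⟩
    have : {t : ℝ | x + t • (q : X) ∈ {x | x ∈ frontier D ∧ x + (q : X) ∈ interior D}} ⊆
        ⋃ k : ℤ, ({t : ℝ | x + t • (q : X) ∈ {x | x ∈ frontier D ∧ x + (q : X) ∈ interior D}} ∩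
          Ico (k : ℝ) (k + 1)) := fun t ht =>
      mem_iUnion.2 ⟨⌊t⌋, ht, Int.floor_le t, Int.lt_floor_add_one t⟩
    refine Set.Countable.mono this (countable_iUnion fun k => Set.Subsingleton.countable ?_)
    have key : ∀ a b : ℝ, (x + a • (q : X) ∈ frontier D ∧ x + a • (q : X) + (q : X) ∈ interior D) →
        x + b • (q : X) ∈ frontier D → a < b → b ≤ a + 1 → False := by
      intro a b ha hb hab hab'
      have := hD.add_smul_mem_interior' (frontier_subset_closure ha.1) ha.2
        (t := b - a) ⟨by linarith, by linarith⟩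
      have e1 : x + a • (q : X) + (b - a) • (q : X) = x + b • (q : X) := by module
      rw [e1] at this
      exact hb.2 this
    rintro a ⟨ha, ha'⟩ b ⟨hb, hb'⟩
    rcases lt_trichotomy a b with h | h | h
    · exact (key a b ha hb.1 h (by linarith [ha'.1, hb'.2])).elim
    · exact h
    · exact (key b a hb ha.1 h (by linarith [hb'.1, ha'.2])).elim
  refine (NullFor.iUnion h1).mono fun x hx => ?_
  obtain ⟨y, hy⟩ := hi
  obtain ⟨q, hqQ, hq⟩ := hQd.exists_mem_open
    (isOpen_interior.preimage (continuous_const_add x) : IsOpen ((fun z => x + z) ⁻¹' interior D))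
    ⟨y - x, by simpa using hy⟩
  exact mem_iUnion.2 ⟨⟨q, hqQ⟩, hx, hq⟩

lemma hadamard_congr {X : Type*} [NormedAddCommGroup X] [NormedSpace ℝ X] {f g : X → ℝ} {x : X}
    (h : f =ᶠ[𝓝 x] g) (hf : HadamardDiffAt f x) : HadamardDiffAt g x := by
  obtain ⟨L, hL⟩ := hf
  refine ⟨L, fun v t ht ht0 hs hhs => ?_⟩
  refine (hL v t ht ht0 hs hhs).congr' ?_
  have h1 : Tendsto (fun n => x + t n • hs n) atTop (𝓝 x) := by
    have := (ht0.smul hhs).const_add x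
    simpa using this
  filter_upwards [h1.eventually h] with n hn
  rw [hn, h.eq_of_nhds]

lemma NullFor.of_local {X : Type*} [NormedAddCommGroup X]
    [SecondCountableTopology X] [MeasurableSpace X] {μ : Measure X} {E S : Set X}
    (h : ∀ x ∈ S, ∃ W ∈ 𝓝 x, NullFor μ (E ∩ W)) : NullFor μ (E ∩ S) := by
  classical
  choose! W hW hn using h
  obtain ⟨t, hts, htc, hcov⟩ := TopologicalSpace.countable_cover_nhdsWithin
    (fun x hx => mem_nhdsWithin_of_mem_nhds (hW x hx))
  have : Countable t := htc.to_subtype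
  refine (NullFor.iUnion fun x : t => hn x (hts x.2)).mono ?_
  rintro x ⟨hxE, hxS⟩
  obtain ⟨y, hy, hxy⟩ := mem_iUnion₂.1 (hcov hxS)
  exact mem_iUnion.2 ⟨⟨y, hy⟩, hxE, hxy⟩

lemma quasi_local {X : Type*} [NormedAddCommGroup X] [NormedSpace ℝ X]
    [TopologicalSpace.SeparableSpace X] [MeasurableSpace X] [BorelSpace X]
    {Q : AddSubgroup X} (hQ : (Q : Set X).Countable) (hQd : Dense (Q : Set X))
    {μ : Measure X} (hμ : GoodFor Q μ) {f : X → ℝ} (hq : QuasiconvexFun f) {α : ℝ} {y : X} {r : ℝ}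
    (hr : 0 < r) (hball : Metric.ball y r ⊆ {x | f x < α}) {x₀ : X}
    (hx₀ : x₀ ∉ closure {x | f x < α}) :
    ∃ W ∈ 𝓝 x₀, NullFor μ ({x | ¬ HadamardDiffAt f x} ∩ W) := by
  obtain ⟨e, heQ, he⟩ := hQd.exists_dist_lt (x₀ - y) (show 0 < r / 4 by positivity)
  rw [dist_eq_norm] at he
  obtain ⟨ρ₀, hρ₀, hρ₀b⟩ := Metric.isOpen_iff.1 isClosed_closure.isOpen_compl x₀ hx₀
  set s := r / 4 with hs
  have hs0 : 0 < s := by positivity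
  set W := Metric.ball x₀ (min ρ₀ s) with hW
  have hx₀W : x₀ ∈ W := Metric.mem_ball_self (lt_min hρ₀ hs0)
  have hαf : ∀ u ∈ W, α ≤ f u := by
    intro u hu
    by_contra hc
    push Not at hc
    exact hρ₀b (Metric.ball_subset_ball (min_le_left _ _) hu) (subset_closure hc)
  have hWs : ∀ u ∈ W, ‖u - x₀‖ < s := by
    intro u hu
    rw [hW, Metric.mem_ball, dist_eq_norm] at hu
    exact hu.trans_le (min_le_right _ _)
  have hmono : ∀ u ∈ W, ∀ (k : X) (t : ℝ), 0 ≤ t → ‖k - t • e‖ ≤ t * s → f u ≤ f (u + k) := by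
    intro u hu k t ht hk
    rcases ht.eq_or_lt with rfl | ht
    · have : k = 0 := by simpa using hk
      simp [this]
    have hz : u - t⁻¹ • k ∈ Metric.ball y r := by
      rw [Metric.mem_ball, dist_eq_norm]
      have e1 : u - t⁻¹ • k - y = (u - x₀) + (x₀ - y - e) + (- (t⁻¹ • (k - t • e))) := by
        rw [smul_sub, smul_smul, inv_mul_cancel₀ ht.ne']
        module
      have e2 : ‖t⁻¹ • (k - t • e)‖ ≤ s := by
        rw [norm_smul, norm_inv, Real.norm_of_nonneg ht.le, inv_mul_le_iff₀ ht]
        exact hk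
      rw [e1]
      have e3 := norm_add₃_le (a := u - x₀) (b := x₀ - y - e) (c := - (t⁻¹ • (k - t • e)))
      rw [norm_neg] at e3
      have := hWs u hu
      linarith
    have hfz : f (u - t⁻¹ • k) < α := hball hz
    have h1 := hq (u + k) (u - t⁻¹ • k) (1 / (t + 1))
      ⟨by positivity, by rw [div_le_one (by positivity)]; linarith⟩
    have e4 : (1 / (t + 1)) • (u + k) + (1 - 1 / (t + 1)) • (u - t⁻¹ • k) = u := by
      have h5 : (1 - 1 / (t + 1)) * t⁻¹ = 1 / (t + 1) := by field_simp; ring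
      have : (1 / (t + 1)) • (u + k) + (1 - 1 / (t + 1)) • (u - t⁻¹ • k)
        = u + (1 / (t + 1)) • k - ((1 - 1 / (t + 1)) * t⁻¹) • k := by module
      rw [this, h5]
      module
    rw [e4] at h1
    rcases le_max_iff.1 h1 with h | h
    · exact h
    · linarith [hαf u hu]
  have hfβ : ∀ u ∈ W, f u ≤ f (x₀ + e) := by
    intro u hu
    have := hmono u hu (x₀ + e - u) 1 zero_le_one (by
      have e1 : x₀ + e - u - (1 : ℝ) • e = - (u - x₀) := by module
      rw [e1, norm_neg, one_mul]
      exact (hWs u hu).le)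
    rwa [add_sub_cancel] at this
  set β := f (x₀ + e) with hβ
  have hαβ : α ≤ β := (hαf x₀ hx₀W).trans (hfβ x₀ hx₀W)
  let S : X → Set ℝ := fun x =>
    insert α {a | ∃ u ∈ W, (∃ t : ℝ, 0 ≤ t ∧ ‖x - u - t • e‖ ≤ t * s) ∧ f u = a}
  have hSb : ∀ x, ∀ a ∈ S x, a ≤ β := by
    rintro x a (rfl | ⟨u, hu, -, rfl⟩)
    · exact hαβ
    · exact hfβ u hu
  have hSbdd : ∀ x, BddAbove (S x) := fun x => ⟨β, hSb x⟩
  have hαS : ∀ x, α ∈ S x := fun x => mem_insert _ _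
  have hFM : ∀ x, |sSup (S x)| ≤ max |α| |β| := by
    intro x
    have h1 : α ≤ sSup (S x) := le_csSup (hSbdd x) (hαS x)
    have h2 : sSup (S x) ≤ β := csSup_le ⟨α, hαS x⟩ (hSb x)
    exact abs_le_max_abs_abs h1 h2
  have hFmono : ∀ (u k : X) (t : ℝ), 0 ≤ t → ‖k - t • e‖ ≤ t * s →
      sSup (S u) ≤ sSup (S (u + k)) := by
    intro u k t ht hk
    refine csSup_le_csSup (hSbdd _) ⟨α, hαS u⟩ ?_
    rintro a (rfl | ⟨v, hv, ⟨t', ht', hv'⟩, rfl⟩)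
    · exact hαS _
    · refine Or.inr ⟨v, hv, ⟨t' + t, by positivity, ?_⟩, rfl⟩
      have e1 : u + k - v - (t' + t) • e = (u - v - t' • e) + (k - t • e) := by module
      rw [e1, add_mul]
      exact (norm_add_le _ _).trans (add_le_add hv' hk)
  have hFf : ∀ x ∈ W, sSup (S x) = f x := by
    intro x hx
    refine le_antisymm (csSup_le ⟨α, hαS x⟩ ?_) (le_csSup (hSbdd x) ?_)
    · rintro a (rfl | ⟨v, hv, ⟨t', ht', hv'⟩, rfl⟩)
      · exact hαf x hx
      · have := hmono v hv (x - v) t' ht' hv'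
        rwa [add_sub_cancel] at this
    · exact Or.inr ⟨x, hx, ⟨0, le_rfl, by simp⟩, rfl⟩
  refine ⟨W, Metric.isOpen_ball.mem_nhds hx₀W, ?_⟩
  refine (cone_mono_null hQ hQd hμ hFM heQ hs0 hFmono).mono ?_
  rintro x ⟨hx, hxW⟩ hc
  refine hx (hadamard_congr ?_ hc)
  filter_upwards [Metric.isOpen_ball.mem_nhds hxW] with z hz
  exact hFf z hz

lemma quasi_convex_lt {X : Type*} [NormedAddCommGroup X] [NormedSpace ℝ X] {f : X → ℝ}
    (hq : QuasiconvexFun f) (α : ℝ) : Convex ℝ {x | f x < α} := by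
  intro x hx y hy a b ha hb hab
  have := hq x y a ⟨ha, by linarith⟩
  have e1 : 1 - a = b := by linarith
  rw [e1] at this
  exact this.trans_lt (max_lt hx hy)

lemma quasi_convex_le {X : Type*} [NormedAddCommGroup X] [NormedSpace ℝ X] {f : X → ℝ}
    (hq : QuasiconvexFun f) (α : ℝ) : Convex ℝ {x | f x ≤ α} := by
  intro x hx y hy a b ha hb hab
  have := hq x y a ⟨ha, by linarith⟩
  have e1 : 1 - a = b := by linarith
  rw [e1] at this
  exact this.trans (max_le hx hy)

lemma interior_sublevel {X : Type*} [NormedAddCommGroup X] [NormedSpace ℝ X] {f : X → ℝ}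
    (hd : DenselyContinuous f) {α : ℝ} (h : ¬ IsMeagre {x : X | f x < α}) :
    (interior {x | f x < α}).Nonempty := by
  by_contra hc
  rw [not_nonempty_iff_eq_empty] at hc
  apply h
  have h1 : {x : X | ContinuousAt f x} ∈ residual X :=
    residual_of_dense_Gδ (IsGδ.setOfPred_continuousAt f) hd
  refine mem_of_superset h1 fun x hx hx' => ?_
  have : x ∈ interior {x | f x < α} :=
    mem_interior_iff_mem_nhds.2 (hx.eventually (gt_mem_nhds hx'))
  rw [hc] at this
  exact this

lemma quasi_above_null {X : Type*} [NormedAddCommGroup X] [NormedSpace ℝ X]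
    [TopologicalSpace.SeparableSpace X] [MeasurableSpace X] [BorelSpace X]
    {Q : AddSubgroup X} (hQ : (Q : Set X).Countable) (hQd : Dense (Q : Set X))
    {μ : Measure X} (hμ : GoodFor Q μ) {f : X → ℝ} (hq : QuasiconvexFun f) {m : ℝ}
    (hInt : ∀ α, m < α → (interior {x | f x < α}).Nonempty) :
    NullFor μ {x | ¬ HadamardDiffAt f x ∧ m < f x} := by
  have : SecondCountableTopology X := UniformSpace.secondCountable_of_separable X
  have hα : ∀ n : ℕ, m < m + 1 / ((n : ℝ) + 1) := fun n => by
    have : (0 : ℝ) < 1 / ((n : ℝ) + 1) := by positivity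
    linarith
  have h1 : ∀ n : ℕ, NullFor μ (frontier {x | f x < m + 1 / ((n : ℝ) + 1)}) := fun n =>
    frontier_null hQ hQd hμ (quasi_convex_lt hq _) (hInt _ (hα n))
  have h2 : ∀ n : ℕ, NullFor μ
      ({x | ¬ HadamardDiffAt f x} ∩ (closure {x | f x < m + 1 / ((n : ℝ) + 1)})ᶜ) := by
    intro n
    obtain ⟨y, hy⟩ := hInt _ (hα n)
    obtain ⟨r, hr, hb⟩ := Metric.isOpen_iff.1 isOpen_interior y hy
    exact NullFor.of_local fun x hx =>
      quasi_local hQ hQd hμ hq hr (hb.trans interior_subset) hx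
  refine ((NullFor.iUnion h1).union (NullFor.iUnion h2)).mono ?_
  rintro x ⟨hx, hmx⟩
  obtain ⟨n, hn⟩ := exists_nat_one_div_lt (sub_pos.2 hmx)
  by_cases hc : x ∈ closure {x | f x < m + 1 / ((n : ℝ) + 1)}
  · refine Or.inl (mem_iUnion.2 ⟨n, hc, fun hi => ?_⟩)
    have := interior_subset hi
    simp only [mem_ofPred_eq] at this
    linarith
  · exact Or.inr (mem_iUnion.2 ⟨n, hx, hc⟩)

lemma NullFor.haarNull {X : Type*} [NormedAddCommGroup X] [MeasurableSpace X] {μ : Measure X}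
    [IsProbabilityMeasure μ] {E : Set X} (h : NullFor μ E) : HaarNull E := by
  obtain ⟨B, h1, h2, h3⟩ := h
  refine ⟨B, h1, h2, μ, inferInstance, fun x => ?_⟩
  have : (fun y => x + y) '' B = {y | -x + y ∈ B} := by
    ext y
    constructor
    · rintro ⟨z, hz, rfl⟩
      simpa using hz
    · intro hy
      exact ⟨-x + y, hy, by simp⟩
  rw [this]
  exact h3 _

/-- On a reflexive separable Banach space, if `{f < m}` is nowhere dense then the set of
points where `f` is not Hadamard differentiable is contained in a Haar null set. -/
theorem stmt_14 {X : Type*} [NormedAddCommGroup X] [NormedSpace ℝ X] [CompleteSpace X]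
    [TopologicalSpace.SeparableSpace X] [MeasurableSpace X] [BorelSpace X]
    (hrefl : IsReflexiveSpace X)
    (f : X → ℝ) (hq : QuasiconvexFun f) (hd : DenselyContinuous f)
    (m : ℝ) (hm : IsTopEssInf f m)
    (hnd : IsNowhereDense {x : X | f x < m}) :
    HaarNull {x : X | ¬ HadamardDiffAt f x} := by
  classical
  let Q : AddSubgroup X :=
    (Finsupp.linearCombination ℤ (TopologicalSpace.denseSeq X)).toAddMonoidHom.range
  have hQ : (Q : Set X).Countable := by
    rw [AddMonoidHom.coe_range]
    exact countable_range _
  have hQd : Dense (Q : Set X) := by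
    refine (TopologicalSpace.denseRange_denseSeq X).mono ?_
    rintro _ ⟨n, rfl⟩
    exact ⟨Finsupp.single n 1, by simp⟩
  have hInt : ∀ α, m < α → (interior {x | f x < α}).Nonempty := fun α hα =>
    interior_sublevel hd (hm.2 α hα)
  by_cases hA : interior (closure {x | f x ≤ m}) = ∅
  · obtain ⟨μ, hμ, hgood, hnull⟩ := exists_good_measure hrefl Q hQ (closure {x | f x ≤ m})
      (quasi_convex_le hq m).closure isClosed_closure hA
    refine ((quasi_above_null hQ hQd hgood hq hInt).union hnull).haarNull.imp fun B hB => ?_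
    refine ⟨fun x hx => hB.1 ?_, hB.2⟩
    rcases lt_or_ge m (f x) with h | h
    · exact Or.inl ⟨hx, h⟩
    · exact Or.inr (subset_closure h)
  · have hsub : interior (closure {x | f x ≤ m}) ⊆ {x | f x ≤ m} := by
      intro x hx
      simp only [mem_ofPred_eq]
      refine le_of_forall_gt fun α hα => ?_
      have h1 : x ∈ interior (closure {x | f x < α}) :=
        interior_mono (closure_mono fun z (hz : f z ≤ m) => hz.trans_lt hα) hx
      rw [(quasi_convex_lt hq α).interior_closure_eq_interior_of_nonempty_interior
        (hInt α hα)] at h1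
      have h2 : x ∈ {x | f x < α} := interior_subset h1
      exact h2
    have hMi : (interior {x | f x ≤ m}).Nonempty :=
      (nonempty_iff_ne_empty.2 hA).mono (interior_maximal hsub isOpen_interior)
    obtain ⟨μ, hμ, hgood, hnull⟩ := exists_good_measure hrefl Q hQ (closure {x | f x < m})
      (quasi_convex_lt hq m).closure isClosed_closure hnd
    refine ((quasi_above_null hQ hQd hgood hq hInt).union (hnull.union
      (frontier_null hQ hQd hgood (quasi_convex_le hq m) hMi))).haarNull.imp fun B hB => ?_
    refine ⟨fun x hx => hB.1 ?_, hB.2⟩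
    rcases lt_or_ge m (f x) with h | h
    · exact Or.inl ⟨hx, h⟩
    · refine Or.inr ?_
      by_contra hc
      simp only [mem_union, not_or] at hc
      obtain ⟨c1, c2⟩ := hc
      have hxi : x ∈ interior {x | f x ≤ m} := by
        by_contra hni
        exact c2 ⟨subset_closure h, hni⟩
      apply hx
      refine hadamard_congr (f := fun _ => m) ?_ ⟨0, fun v t ht ht0 hs hhs => by simp⟩
      filter_upwards [isOpen_interior.mem_nhds hxi, isClosed_closure.isOpen_compl.mem_nhds c1]
        with z hz hz'
      have h0 : z ∈ {x | f x ≤ m} := interior_subset hz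
      have h1 : f z ≤ m := h0
      have h2 : ¬ f z < m := fun h => hz' (subset_closure h)
      exact le_antisymm (not_lt.1 h2) h1
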